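/- Let h(x,z) = 32768x³ − 768x²z + 1824xz² − 243z³ and consider the degree 15 plane curve D₀ : x z h(x,z) f₀ = 0. Then the point q = (0:1:0) is a modular point for D₀ (so D₀ is a supersolvable curve), and D₀ is a 4-syzygy curve with exponents (8,8,8,8); in particular D₀ is a maximal Tjurina curve of type (15,8) and is NOT free. Hence a supersolvable plane curve need not be free. -/

import Mathlib

open MvPolynomial

noncomputable section

/-- `S = ℂ[x,y,z]`, with `x = X 0`, `y = X 1`, `z = X 2`. -/
abbrev S3 := MvPolynomial (Fin 3) ℂ

/-- The graded `S`-module `D_0(f)` of Jacobian syzygies of `f`. -/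
def jacSyz (f : S3) : Submodule S3 (Fin 3 → S3) where
  carrier := {v | v 0 * pderiv 0 f + v 1 * pderiv 1 f + v 2 * pderiv 2 f = 0}
  add_mem' := by
    intro a b ha hb
    simp only [Set.mem_setOf_eq, Pi.add_apply] at *
    linear_combination ha + hb
  zero_mem' := by simp
  smul_mem' := by
    intro c v hv
    simp only [Set.mem_setOf_eq, Pi.smul_apply, smul_eq_mul] at *
    linear_combination c * hv

/-- `v` is a minimal system of `m` homogeneous generators of `D_0(f)`, the generator
`v j` being a syzygy of degree `dd j`, and `dd` nondecreasing: this says that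
`C : f = 0` is an `m`-syzygy curve with exponents `dd`. -/
structure IsMinGenSyz (f : S3) (m : ℕ) (dd : Fin m → ℕ) (v : Fin m → (Fin 3 → S3)) : Prop where
  mem : ∀ j, v j ∈ jacSyz f
  hom : ∀ j i, ((v j) i).IsHomogeneous (dd j)
  ne_zero : ∀ j, v j ≠ 0
  span_eq : Submodule.span S3 (Set.range v) = jacSyz f
  minimal : ∀ j, v j ∉ Submodule.span S3 (v '' {j' | j' ≠ j})
  mono : Monotone dd

/-- `C : f = 0` is free with exponents `(d1, d2)`. -/
def IsFreeWith (f : S3) (d1 d2 : ℕ) : Prop := ∃ v, IsMinGenSyz f 2 ![d1, d2] v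

/-- `C : f = 0` is a free curve (a 2-syzygy curve). -/
def IsFreeCurve (f : S3) : Prop := ∃ d1 d2, IsFreeWith f d1 d2

/-- `C : f = 0` of degree `d` is nearly free with exponents `(d1, d2)`:
a 3-syzygy curve with exponents `(d1, d2, d2)` and `d1 + d2 = d`. -/
def IsNearlyFreeWith (f : S3) (d d1 d2 : ℕ) : Prop :=
  d1 + d2 = d ∧ ∃ v, IsMinGenSyz f 3 ![d1, d2, d2] v

/-- `C : f = 0` of degree `d` is a nearly free curve. -/
def IsNearlyFree (f : S3) (d : ℕ) : Prop := ∃ d1 d2, IsNearlyFreeWith f d d1 d2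

/-- `C : f = 0` of degree `d` is plus-one generated with exponents `(d1, d2, d3)`:
a 3-syzygy curve with `d1 + d2 = d`. -/
def IsPOGWith (f : S3) (d d1 d2 d3 : ℕ) : Prop :=
  d1 + d2 = d ∧ ∃ v, IsMinGenSyz f 3 ![d1, d2, d3] v

/-- `C : f = 0` of degree `d` is a plus-one generated curve. -/
def IsPOG (f : S3) (d : ℕ) : Prop := ∃ d1 d2 d3, IsPOGWith f d d1 d2 d3

/-- `C : f = 0` of degree `d` is minimal plus-one generated (MPOG),
with exponents `(d1, d2, d2 + 1)`. -/
def IsMPOGWith (f : S3) (d d1 d2 : ℕ) : Prop := IsPOGWith f d d1 d2 (d2 + 1)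

/-- `C : f = 0` of degree `d` is an MPOG-curve. -/
def IsMPOG (f : S3) (d : ℕ) : Prop := ∃ d1 d2, IsMPOGWith f d d1 d2

/-- `r = mdr(f)`: the minimal degree of a nonzero (homogeneous) Jacobian relation for `f`. -/
def IsMDR (f : S3) (r : ℕ) : Prop :=
  (∃ v ∈ jacSyz f, v ≠ 0 ∧ ∀ i, (v i).IsHomogeneous r) ∧
  ∀ m, m < r → ∀ v ∈ jacSyz f, (∀ i, (v i).IsHomogeneous m) → v = 0

/-- The Jacobian ideal `J_f` of `f`. -/
def jacobianIdeal (f : S3) : Ideal S3 := Ideal.span {pderiv 0 f, pderiv 1 f, pderiv 2 f}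

/-- The dimension of the degree `k` graded piece of the Milnor algebra `M(f) = S/J_f`. -/
def milnorDim (f : S3) (k : ℕ) : ℕ :=
  Module.finrank ℂ
    (↥(homogeneousSubmodule (Fin 3) ℂ k) ⧸
      (Submodule.comap (homogeneousSubmodule (Fin 3) ℂ k).subtype
        (Submodule.restrictScalars ℂ (jacobianIdeal f))))

/-- `τ` is the total Tjurina number of the reduced curve `C : f = 0`, i.e. the degree of the
Jacobian ideal `J_f`: for all large `k` one has `dim M(f)_k = τ`. -/
def IsTjurina (f : S3) (τ : ℕ) : Prop := ∀ᶠ k in Filter.atTop, milnorDim f k = τ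

/-- `C : f = 0` is a maximal Tjurina curve of type `(d, r)`. -/
def IsMaxTjurina (f : S3) (d r : ℕ) : Prop :=
  IsMDR f r ∧ d ≤ 2 * r ∧
  ∃ τ : ℕ, IsTjurina f τ ∧
    (τ : ℤ) = ((d : ℤ) - 1) ^ 2 - r * ((d : ℤ) - r - 1) - (Nat.choose (2 * r + 2 - d) 2 : ℤ)

/-- `f` is a product of `d` linear forms all vanishing at a common point, i.e.
`C : f = 0` is the union of `d` lines passing through one point. -/
def IsUnionOfConcurrentLines (f : S3) (d : ℕ) : Prop :=
  ∃ (c : ℂ) (L : Fin d → Fin 3 → ℂ) (v : Fin 3 → ℂ), v ≠ 0 ∧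
    f = C c * ∏ j, (∑ i, C (L j i) * X i) ∧ ∀ j, (∑ i, L j i * v i) = 0

/-- The ideal `I_θ` generated by the 2×2 minors of the matrix with rows `(x,y,z)` and
`(a,b,c)`, defining the eigenscheme `Γ_θ` of the derivation `θ = a ∂_x + b ∂_y + c ∂_z`. -/
def eigenIdeal (a b c : S3) : Ideal S3 :=
  Ideal.span {X 1 * c - X 2 * b, X 2 * a - X 0 * c, X 0 * b - X 1 * a}

/-- The projective plane `ℙ²(ℂ)`. -/
abbrev Pt := Projectivization ℂ (Fin 3 → ℂ)

/-- The eigenscheme `Γ_θ` of `θ = a ∂_x + b ∂_y + c ∂_z` is 0-dimensional: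
its set of points in `ℙ²` is finite. -/
def EigenSchemeFinite (a b c : S3) : Prop :=
  {p : Pt | eval p.rep (X 1 * c - X 2 * b) = 0 ∧ eval p.rep (X 2 * a - X 0 * c) = 0 ∧
      eval p.rep (X 0 * b - X 1 * a) = 0}.Finite

/-- The homogenization `f₀` of the Briançon polynomial `g`. -/
def f0 : S3 :=
  X 0 ^ 6 * X 1 ^ 4 + 4 * X 0 ^ 5 * X 1 ^ 3 * X 2 ^ 2 + 3 * X 0 ^ 4 * X 1 ^ 3 * X 2 ^ 3 +
    6 * X 0 ^ 4 * X 1 ^ 2 * X 2 ^ 4 + C (19 / 3 : ℂ) * X 0 ^ 3 * X 1 ^ 2 * X 2 ^ 5 +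
    4 * X 0 ^ 3 * X 1 * X 2 ^ 6 + 3 * X 0 ^ 2 * X 1 ^ 2 * X 2 ^ 6 +
    C (11 / 3 : ℂ) * X 0 ^ 2 * X 1 * X 2 ^ 7 + X 0 ^ 2 * X 2 ^ 8 + 2 * X 0 * X 1 * X 2 ^ 8 +
    C (1 / 3 : ℂ) * X 0 * X 2 ^ 9 + X 1 * X 2 ^ 9 - X 2 ^ 10

/-- `f_b = f₀ + (16/9) z¹⁰`. -/
def fb : S3 := f0 + C (16 / 9 : ℂ) * X 2 ^ 10

/-- `f₁ = f₀ - z¹⁰`. -/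
def f1 : S3 := f0 - X 2 ^ 10

/-- The linear form with coefficients `α`. -/
def linForm (α : Fin 3 → ℂ) : S3 := ∑ i, C (α i) * X i

/-- The projective line `{α₀ x + α₁ y + α₂ z = 0}` as a set of points of `ℙ²`. -/
def lineSet (α : Fin 3 → ℂ) : Set Pt := {p | ∑ i, α i * p.rep i = 0}

/-- The set of points of the curve `F = 0` in `ℙ²` (for `F` homogeneous). -/
def curveSet (F : S3) : Set Pt := {p | eval p.rep F = 0}

/-- The restriction of `F` to the parametrized line `t ↦ v + t • w`. -/
def restrictToLine (F : S3) (v w : Fin 3 → ℂ) : Polynomial ℂ :=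
  MvPolynomial.aeval (fun i => Polynomial.C (v i) + Polynomial.X * Polynomial.C (w i)) F

/-- The multiplicity `mult_q` of the curve `F = 0` at the point `q` with coordinates `v`:
the minimal order of vanishing at `t = 0` of `F(v + t w)` over all directions `w` for
which this restriction is not identically zero. -/
def multAt (F : S3) (v : Fin 3 → ℂ) : ℕ :=
  sInf {m | ∃ w, restrictToLine F v w ≠ 0 ∧ m = (restrictToLine F v w).rootMultiplicity 0}

/-- `q` is a modular point for the degree `e` curve `F = 0`: every line through `q` which
is not an irreducible component of the curve meets the curve in exactly
`e - mult_q + 1` points. -/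
def IsModularPoint (F : S3) (e : ℕ) (q : Pt) : Prop :=
  ∀ α : Fin 3 → ℂ, α ≠ 0 → (∑ i, α i * q.rep i = 0) → ¬ (linForm α ∣ F) →
    (lineSet α ∩ curveSet F).ncard = e - multAt F q.rep + 1

/-- A reduced curve of degree `e` is supersolvable if it has a modular point. -/
def IsSupersolvable (F : S3) (e : ℕ) : Prop := ∃ q : Pt, IsModularPoint F e q

/-- The point `q = (0:1:0)`. -/
def qPoint : Pt := Projectivization.mk ℂ ![0, 1, 0] (by
  intro h
  have := congrFun h 1
  norm_num at this)

/-- The cubic form `h(x,z)` whose linear factors are the three remaining exceptional lines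
through `q = (0:1:0)` for the curve `C₀`. -/
def hCubic : S3 := 32768 * X 0 ^ 3 - 768 * X 0 ^ 2 * X 2 + 1824 * X 0 * X 2 ^ 2 - 243 * X 2 ^ 3

/-- The degree 15 curve `D₀ : x z h(x,z) f₀ = 0`. -/
def D0curve : S3 := X 0 * X 2 * hCubic * f0

/-- The polynomial `∑ c xⁱ yʲ zᵏ` over the terms `(c, i, j, k)` of a list. -/
def ofTerms (l : List (ℤ × ℕ × ℕ × ℕ)) : S3 :=
  (l.map fun t => (t.1 : S3) * X 0 ^ t.2.1 * X 1 ^ t.2.2.1 * X 2 ^ t.2.2.2).sum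

/-- The first generator of the Jacobian syzygies of `D₀`, up to a constant factor. -/
def firstSyz : Fin 3 → S3 :=
  ![ofTerms
      [(111375548416, 7, 1, 0), (-799552512, 6, 2, 0), (-36914331648, 6, 1, 1),
      (111375548416, 6, 0, 2), (-1624212, 5, 3, 0), (23146560, 5, 2, 1), (8615196672, 5, 1, 2),
      (46617329664, 5, 0, 3), (-45048960, 4, 2, 2), (-3259683072, 4, 1, 3), (1425386496, 4, 0, 4),
      (4784427, 3, 2, 3), (348557796, 3, 1, 4), (2482137792, 3, 0, 5), (20104605, 2, 1, 5),
      (-945529488, 2, 0, 6), (-3137616, 1, 1, 6), (65712384, 1, 0, 7)],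
    ofTerms
      [(-268313821184, 6, 2, 0), (1956572928, 5, 3, 0), (88120983552, 5, 2, 1),
      (-344251695104, 5, 1, 2), (4466583, 4, 4, 0), (-52300080, 4, 3, 1), (-15967319808, 4, 2, 2),
      (-31153913856, 4, 1, 3), (-75937873920, 4, 0, 4), (89530515, 3, 3, 2), (5834398608, 3, 2, 3),
      (-25490160384, 3, 1, 4), (25007063040, 3, 0, 5), (-1404783, 2, 3, 3), (-599122359, 2, 2, 4),
      (-422524368, 2, 1, 5), (3712838400, 2, 0, 6), (-72092025, 1, 2, 5), (790846317, 1, 1, 6),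
      (-933567120, 1, 0, 7), (13221144, 0, 2, 6), (-78765696, 0, 1, 7), (64696320, 0, 0, 8)],
    ofTerms
      [(-40500199424, 6, 1, 1), (169233408, 5, 2, 1), (13099794432, 5, 1, 2),
      (-40500199424, 5, 0, 3), (-1624212, 4, 3, 1), (440640, 4, 2, 2), (-1011652608, 4, 1, 3),
      (-17275355136, 4, 0, 4), (8877600, 3, 2, 3), (135906048, 3, 1, 4), (3423230976, 3, 0, 5),
      (-2399868, 2, 2, 4), (6847956, 2, 1, 5), (-354166848, 2, 0, 6), (2998620, 1, 1, 6),
      (48474432, 1, 0, 7), (-775656, 0, 1, 7), (-72576, 0, 0, 8)]]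

/-- The second generator of the Jacobian syzygies of `D₀`, up to a constant factor. -/
def secondSyz : Fin 3 → S3 :=
  ![ofTerms
      [(2266266337280, 7, 1, 0), (-16303546368, 6, 2, 0), (-748804898816, 6, 1, 1),
      (2266266337280, 6, 0, 2), (-32838048, 5, 3, 0), (467043840, 5, 2, 1), (174627569664, 5, 1, 2),
      (950894854144, 5, 0, 3), (-918796608, 4, 2, 2), (-66275097600, 4, 1, 3),
      (30108917760, 4, 0, 4), (97961076, 3, 2, 3), (7025776416, 3, 1, 4), (50664340992, 3, 0, 5),
      (407429460, 2, 1, 5), (-19182765888, 2, 0, 6), (-62651961, 1, 1, 6), (1325258064, 1, 0, 7)],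
    ofTerms
      [(-5459641630720, 6, 2, 0), (39897925632, 5, 3, 0), (1787477622784, 5, 2, 1),
      (-7004823224320, 5, 1, 2), (90304632, 4, 4, 0), (-1052956800, 4, 3, 1),
      (-323238168576, 4, 2, 2), (-641110900736, 4, 1, 3), (-1545181593600, 4, 0, 4),
      (1825421832, 3, 3, 2), (118708575360, 3, 2, 3), (-519648061440, 3, 1, 4),
      (507256504320, 3, 0, 5), (-30594429, 2, 3, 3), (-12047467464, 2, 2, 4),
      (-9229170048, 2, 1, 5), (76009236480, 2, 0, 6), (-1462080510, 1, 2, 5),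
      (16068798072, 1, 1, 6), (-18941143680, 1, 0, 7), (266003109, 0, 2, 6), (-1587876561, 0, 1, 7),
      (1304767440, 0, 0, 8)],
    ofTerms
      [(-824096849920, 6, 1, 1), (3443761152, 5, 2, 1), (265708109824, 5, 1, 2),
      (-824096849920, 5, 0, 3), (-32838048, 4, 3, 1), (4216320, 4, 2, 2), (-20371193856, 4, 1, 3),
      (-352364527616, 4, 0, 4), (180418752, 3, 2, 3), (2764354560, 3, 1, 4), (69234892800, 3, 0, 5),
      (-48480444, 2, 2, 4), (138175776, 2, 1, 5), (-7187808768, 2, 0, 6), (61216020, 1, 1, 6),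
      (977637312, 1, 0, 7), (-15642396, 0, 1, 7), (-1463616, 0, 0, 8)]]

/-- The third generator of the Jacobian syzygies of `D₀`, up to a constant factor. -/
def thirdSyz : Fin 3 → S3 :=
  ![ofTerms
      [(17292276531200, 7, 1, 0), (-124659302400, 6, 2, 0), (-5696022118400, 6, 1, 1),
      (17292276531200, 6, 0, 2), (-248956416, 5, 3, 0), (3533635584, 5, 2, 1),
      (1327348383744, 5, 1, 2), (7273185280000, 5, 0, 3), (-7026775488, 4, 2, 2),
      (-505304491008, 4, 1, 3), (238071250944, 4, 0, 4), (752062644, 3, 2, 3),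
      (53103873024, 3, 1, 4), (387776510976, 3, 0, 5), (3096169380, 2, 1, 5),
      (-145942463808, 2, 0, 6), (-469005795, 1, 1, 6), (10022713200, 1, 0, 7)],
    ofTerms
      [(-41658666188800, 6, 2, 0), (305079091200, 5, 3, 0), (13596629401600, 5, 2, 1),
      (-53448854732800, 5, 1, 2), (684630144, 4, 4, 0), (-7948717056, 4, 3, 1),
      (-2453781037056, 4, 2, 2), (-4946198528000, 4, 1, 3), (-11790188544000, 4, 0, 4),
      (13955937552, 3, 3, 2), (905727305472, 3, 2, 3), (-3972369678336, 3, 1, 4),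
      (3858530304000, 3, 0, 5), (-248675751, 2, 3, 3), (-90838822896, 2, 2, 4),
      (-75189778944, 2, 1, 5), (583467909120, 2, 0, 6), (-11119135410, 1, 2, 5),
      (122441434992, 1, 1, 6), (-144120556800, 1, 0, 7), (2006743815, 0, 2, 6),
      (-12003862635, 0, 1, 7), (9867763440, 0, 0, 8)],
    ofTerms
      [(-6288100556800, 6, 1, 1), (26276659200, 5, 2, 1), (2021038489600, 5, 1, 2),
      (-6288100556800, 5, 0, 3), (-248956416, 4, 3, 1), (-3926016, 4, 2, 2),
      (-153819119616, 4, 1, 3), (-2695036928000, 4, 0, 4), (1374933312, 3, 2, 3),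
      (21083753472, 3, 1, 4), (525107625984, 3, 0, 5), (-367243956, 2, 2, 4), (1045367424, 2, 1, 5),
      (-54703832064, 2, 0, 6), (468603900, 1, 1, 6), (7393326912, 1, 0, 7), (-118287540, 0, 1, 7),
      (-11067840, 0, 0, 8)]]

/-- The fourth generator of the Jacobian syzygies of `D₀`, up to a constant factor. -/
def fourthSyz : Fin 3 → S3 :=
  ![ofTerms
      [(16492716359680, 7, 1, 0), (-119138964480, 6, 2, 0), (-5416050491392, 6, 1, 1),
      (16492716359680, 6, 0, 2), (-235917036, 5, 3, 0), (3341621952, 5, 2, 1),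
      (1261130889216, 5, 1, 2), (6953486778368, 5, 0, 3), (-6716977920, 4, 2, 2),
      (-481573312512, 4, 1, 3), (234912648192, 4, 0, 4), (721624221, 3, 2, 3),
      (50170568652, 3, 1, 4), (370972776768, 3, 0, 5), (2940973515, 2, 1, 5),
      (-138792251520, 2, 0, 6), (-438737958, 1, 1, 6), (9475040124, 1, 0, 7)],
    ofTerms
      [(-39732453048320, 6, 2, 0), (291582478080, 5, 3, 0), (12927960055808, 5, 2, 1),
      (-50977486929920, 5, 1, 2), (648771849, 4, 4, 0), (-7499631888, 4, 3, 1),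
      (-2328359956224, 4, 2, 2), (-4768802209792, 4, 1, 3), (-11245033881600, 4, 0, 4),
      (13336364205, 3, 3, 2), (863815268208, 3, 2, 3), (-3795529052928, 3, 1, 4),
      (3668802109440, 3, 0, 5), (-251605359, 2, 3, 3), (-85609314333, 2, 2, 4),
      (-76212523632, 2, 1, 5), (559805448960, 2, 0, 6), (-10569760875, 1, 2, 5),
      (116628877755, 1, 1, 6), (-137083123440, 1, 0, 7), (1892181222, 0, 2, 6),
      (-11343044466, 0, 1, 7), (9328599900, 0, 0, 8)],
    ofTerms
      [(-5997351403520, 6, 1, 1), (25059732480, 5, 2, 1), (1921553727488, 5, 1, 2),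
      (-5997351403520, 5, 0, 3), (-235917036, 4, 3, 1), (-38035008, 4, 2, 2),
      (-145174861824, 4, 1, 3), (-2576459825152, 4, 0, 4), (1309707360, 3, 2, 3),
      (20099255808, 3, 1, 4), (497834621952, 3, 0, 5), (-347720364, 2, 2, 4), (988442172, 2, 1, 5),
      (-52041565632, 2, 0, 6), (448356060, 1, 1, 6), (6988392720, 1, 0, 7), (-111803328, 0, 1, 7),
      (-10460016, 0, 0, 8)]]

section AbstractSyzygies

open Matrix

variable {R : Type*} [CommRing R]

/-- `a, b, c` behave like a regular sequence: syzygies of `b, c` modulo `a` are Koszul. -/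
structure IsKoszulTriple (a b c : R) : Prop where
  ne_zero : a ≠ 0
  dvd_of_dvd_mul : ∀ p, a ∣ b * p → a ∣ p
  exists_of_dvd : ∀ p q, a ∣ b * p + c * q → ∃ e p' q', p = c * e + a * p' ∧ q = -(b * e) + a * q'

/-- Vectors parallel to `G` are multiples of `G`. -/
def IsPrimitiveVec (G : Fin 3 → R) : Prop :=
  ∀ u : Fin 3 → R, (∀ i j, u i * G j = u j * G i) → ∃ p : R, u = p • G

theorem cross_parallel {v w G : Fin 3 → R} (hv : v ⬝ᵥ G = 0) (hw : w ⬝ᵥ G = 0) (i j : Fin 3) :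
    (v ⨯₃ w) i * G j = (v ⨯₃ w) j * G i := by
  simp only [dotProduct, Fin.sum_univ_three] at hv hw
  fin_cases i <;> fin_cases j <;> simp [cross_apply]
  · linear_combination w 2 * hv - v 2 * hw
  · linear_combination v 1 * hw - w 1 * hv
  · linear_combination v 2 * hw - w 2 * hv
  · linear_combination w 0 * hv - v 0 * hw
  · linear_combination w 1 * hv - v 1 * hw
  · linear_combination v 0 * hw - w 0 * hv

variable [IsDomain R]

theorem eq_zero_of_cross_eq_zero {a b w : Fin 3 → R} (hab : a ⨯₃ b ≠ 0)
    (ha : w ⨯₃ a = 0) (hb : w ⨯₃ b = 0) : w = 0 := by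
  have key (i j : Fin 3) : w i * (a ⨯₃ b) j = 0 := by
    have ha' := congrFun ha
    have hb' := congrFun hb
    have hdet : (w ⨯₃ a) ⬝ᵥ b = 0 := by rw [ha, zero_dotProduct]
    have hi := ha' j
    have hj := hb' j
    simp only [dotProduct, Fin.sum_univ_three] at hdet
    fin_cases i <;> fin_cases j <;> simp [cross_apply, -mul_eq_zero] at hi hj hdet ⊢
    · linear_combination a 0 * hj - b 0 * hi + hdet
    · linear_combination a 0 * hj - b 0 * hi
    · linear_combination a 0 * hj - b 0 * hi
    · linear_combination a 1 * hj - b 1 * hi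
    · linear_combination a 1 * hj - b 1 * hi + hdet
    · linear_combination a 1 * hj - b 1 * hi
    · linear_combination a 2 * hj - b 2 * hi
    · linear_combination a 2 * hj - b 2 * hi
    · linear_combination a 2 * hj - b 2 * hi + hdet
  obtain ⟨j, hj⟩ := Function.ne_iff.mp hab
  funext i
  exact (mul_eq_zero.mp (key i j)).resolve_right hj

/-- Four vectors orthogonal to `G` with the two standard linear relations
`a v₀ + b v₁ + c v₂ = 0 = a v₁ + b v₂ + c v₃`. -/
structure IsSyzygyFrame (a b c : R) (G : Fin 3 → R) (v : Fin 4 → Fin 3 → R) : Prop where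
  koszul : IsKoszulTriple a b c
  ne_zero : G ≠ 0
  primitive : IsPrimitiveVec G
  rel_left : a • v 0 + b • v 1 + c • v 2 = 0
  rel_right : a • v 1 + b • v 2 + c • v 3 = 0
  cross_eq : v 2 ⨯₃ v 3 = a ^ 2 • G

namespace IsSyzygyFrame

variable {a b c : R} {G : Fin 3 → R} {v : Fin 4 → Fin 3 → R}

theorem cross_ne_zero (h : IsSyzygyFrame a b c G v) : v 2 ⨯₃ v 3 ≠ 0 := by
  rw [h.cross_eq]
  exact smul_ne_zero (pow_ne_zero 2 h.koszul.ne_zero) h.ne_zero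

theorem eq_zero_of_comb (h : IsSyzygyFrame a b c G v) {p q : R}
    (hpq : p • v 2 + q • v 3 = 0) : p = 0 ∧ q = 0 := by
  constructor
  · have := congrArg (fun w => w ⨯₃ v 3) hpq
    simpa [h.cross_ne_zero] using this
  · have := congrArg (fun w => v 2 ⨯₃ w) hpq
    simpa [h.cross_ne_zero] using this

theorem dotProduct_eq_zero (h : IsSyzygyFrame a b c G v) (j : Fin 4) : v j ⬝ᵥ G = 0 := by
  have ha := h.koszul.ne_zero
  have h2 : v 2 ⬝ᵥ G = 0 := by
    have := dot_self_cross (v 2) (v 3)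
    rw [h.cross_eq, dotProduct_smul, smul_eq_mul] at this
    exact (mul_eq_zero.mp this).resolve_left (pow_ne_zero 2 ha)
  have h3 : v 3 ⬝ᵥ G = 0 := by
    have := dot_cross_self (v 2) (v 3)
    rw [h.cross_eq, dotProduct_smul, smul_eq_mul] at this
    exact (mul_eq_zero.mp this).resolve_left (pow_ne_zero 2 ha)
  have h1 : v 1 ⬝ᵥ G = 0 := by
    have := congrArg (fun w => w ⬝ᵥ G) h.rel_right
    simpa [h2, h3, ha] using this
  have h0 : v 0 ⬝ᵥ G = 0 := by
    have := congrArg (fun w => w ⬝ᵥ G) h.rel_left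
    simpa [h1, h2, ha] using this
  fin_cases j <;> assumption

/-- The relations among the `v j` are generated by the two standard ones. -/
theorem exists_of_relation (h : IsSyzygyFrame a b c G v) (r : Fin 4 → R)
    (hr : ∑ j, r j • v j = 0) :
    ∃ s t, r 0 = a * s ∧ r 1 = b * s + a * t ∧ r 2 = c * s + b * t ∧ r 3 = c * t := by
  have ha := h.koszul.ne_zero
  rw [Fin.sum_univ_four] at hr
  have key : (r 0 * (b ^ 2 - a * c) - r 1 * (a * b) + r 2 * a ^ 2) • v 2 +
      (r 0 * (b * c) - r 1 * (a * c) + r 3 * a ^ 2) • v 3 = 0 := by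
    linear_combination (norm := module) (a ^ 2) • hr - (a * r 0) • h.rel_left
      + (b * r 0 - a * r 1) • h.rel_right
  obtain ⟨e1, e2⟩ := h.eq_zero_of_comb key
  obtain ⟨s, hs⟩ : a ∣ r 0 := by
    apply h.koszul.dvd_of_dvd_mul
    apply h.koszul.dvd_of_dvd_mul
    exact ⟨r 0 * c + r 1 * b - r 2 * a, by linear_combination e1⟩
  have e3 : b * (b * s - r 1) = a * (c * s - r 2) := by
    apply mul_left_cancel₀ ha
    rw [hs] at e1
    linear_combination e1
  obtain ⟨t, ht⟩ : a ∣ b * s - r 1 := h.koszul.dvd_of_dvd_mul _ ⟨_, e3⟩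
  refine ⟨s, -t, hs, by linear_combination -ht, ?_, ?_⟩
  · apply mul_left_cancel₀ ha
    linear_combination e3 - b * ht
  · apply mul_left_cancel₀ (pow_ne_zero 2 ha)
    rw [hs] at e2
    linear_combination e2 - a * c * ht

/-- Every vector orthogonal to `G` is a combination of the `v j`. -/
theorem mem_span (h : IsSyzygyFrame a b c G v) {w : Fin 3 → R} (hw : w ⬝ᵥ G = 0) :
    w ∈ Submodule.span R (Set.range v) := by
  have ha := h.koszul.ne_zero
  choose p hp using fun j => h.primitive (w ⨯₃ v j)
    (cross_parallel hw (h.dotProduct_eq_zero j))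
  have cancel {s : R} (hs : s • G = 0) : s = 0 := (smul_eq_zero.mp hs).resolve_right h.ne_zero
  have q1 : a * p 0 + b * p 1 + c * p 2 = 0 := by
    apply cancel
    have := congrArg (fun u => w ⨯₃ u) h.rel_left
    simpa [hp, add_smul, mul_smul] using this
  have q2 : a * p 1 + b * p 2 + c * p 3 = 0 := by
    apply cancel
    have := congrArg (fun u => w ⨯₃ u) h.rel_right
    simpa [hp, add_smul, mul_smul] using this
  have hw2 : a ^ 2 • w = p 3 • v 2 - p 2 • v 3 := by
    rw [← sub_eq_zero]
    apply eq_zero_of_cross_eq_zero h.cross_ne_zero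
    · have h32 : v 3 ⨯₃ v 2 = -(a ^ 2 • G) := by rw [← h.cross_eq, cross_anticomm]
      simp [hp, h32, smul_smul, mul_comm]
    · simp [hp, h.cross_eq, smul_smul, mul_comm]
  obtain ⟨e, α, β, hα, hβ⟩ := h.koszul.exists_of_dvd (p 2) (p 3) ⟨-p 1, by linear_combination q2⟩
  have hp1 : p 1 = -(b * α + c * β) := by
    apply mul_left_cancel₀ ha
    linear_combination q2 - b * hα - c * hβ
  obtain ⟨k, m, n, hm, hn⟩ := h.koszul.exists_of_dvd (b * α + c * β) (-(c * e))
    ⟨p 0 + c * α, by linear_combination b * hp1 + c * hα - q1⟩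
  obtain ⟨k₂, m₂, n₂, hm₂, hn₂⟩ := h.koszul.exists_of_dvd k (-e)
    ⟨n, by linear_combination hn⟩
  obtain ⟨j, m₃, n₃, hm₃, hn₃⟩ := h.koszul.exists_of_dvd α (β - c * k₂)
    ⟨m + c * m₂, by linear_combination hm + c * hm₂⟩
  have hw1 : w = (-k₂) • v 0 + (j - n₂) • v 1 + n₃ • v 2 + (-m₃) • v 3 := by
    apply smul_right_injective _ (pow_ne_zero 2 ha)
    have hβ' : β = c * k₂ - b * j + a * n₃ := by linear_combination hn₃
    have he : e = b * k₂ - a * n₂ := by linear_combination -hn₂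
    simp only [hw2, hα, hβ, hβ', he, hm₃]
    linear_combination (norm := module)
      (a * k₂) • h.rel_left - (b * k₂ - a * n₂ + a * j) • h.rel_right
  rw [hw1]
  have hv (j : Fin 4) (s : R) : s • v j ∈ Submodule.span R (Set.range v) :=
    Submodule.smul_mem _ _ (Submodule.subset_span ⟨j, rfl⟩)
  exact add_mem (add_mem (add_mem (hv _ _) (hv _ _)) (hv _ _)) (hv _ _)

end IsSyzygyFrame

end AbstractSyzygies

section LinearForms

theorem IsKoszulTriple.map_ringEquiv {R S : Type*} [CommRing R] [CommRing S] (φ : R ≃+* S)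
    {a b c : R} (h : IsKoszulTriple a b c) : IsKoszulTriple (φ a) (φ b) (φ c) where
  ne_zero := by simpa using h.ne_zero
  dvd_of_dvd_mul p hp := by
    obtain ⟨p, rfl⟩ := φ.surjective p
    rw [← map_mul, map_dvd_iff] at hp
    exact map_dvd φ (h.dvd_of_dvd_mul p hp)
  exists_of_dvd p q hpq := by
    obtain ⟨p, rfl⟩ := φ.surjective p
    obtain ⟨q, rfl⟩ := φ.surjective q
    rw [← map_mul, ← map_mul, ← map_add, map_dvd_iff] at hpq
    obtain ⟨e, p', q', rfl, rfl⟩ := h.exists_of_dvd p q hpq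
    exact ⟨φ e, φ p', φ q', by simp, by simp⟩

theorem dvd_sub_of_dvd_X_sub {l : S3} {σ : S3 →ₐ[ℂ] S3} (h : ∀ i, l ∣ X i - σ (X i)) (p : S3) :
    l ∣ p - σ p := by
  have hσ : (Ideal.Quotient.mkₐ ℂ (Ideal.span {l})).comp σ = Ideal.Quotient.mkₐ ℂ _ := by
    ext i
    simpa [Ideal.Quotient.eq, Ideal.mem_span_singleton] using (dvd_sub_comm.mp (h i))
  have := DFunLike.congr_fun hσ p
  rw [dvd_sub_comm]
  simpa [Ideal.Quotient.eq, Ideal.mem_span_singleton] using this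

theorem isKoszulTriple_X : IsKoszulTriple (X 0 : S3) (X 1) (X 2) where
  ne_zero := X_ne_zero 0
  dvd_of_dvd_mul p hp :=
    ((X_prime (R := ℂ) (i := (0 : Fin 3))).dvd_or_dvd hp).resolve_left (by simp [X_dvd_X])
  exists_of_dvd p q hpq := by
    set σ : S3 →ₐ[ℂ] S3 := aeval ![0, X 1, X 2] with hσ
    have hX : ∀ i, (X 0 : S3) ∣ X i - σ (X i) := by
      intro i
      fin_cases i <;> simp [hσ]
    have h0 : X 1 * σ p + X 2 * σ q = 0 := by
      obtain ⟨r, hr⟩ := hpq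
      have := congrArg σ hr
      simpa [hσ] using this
    obtain ⟨e, he⟩ : X 2 ∣ σ p := by
      refine ((X_prime (R := ℂ) (i := (2 : Fin 3))).dvd_or_dvd (a := X 1) ⟨-σ q, ?_⟩).resolve_left
        (by simp [X_dvd_X])
      linear_combination h0
    have hq : σ q = -(X 1 * e) := by
      apply mul_left_cancel₀ (X_ne_zero (R := ℂ) (2 : Fin 3))
      linear_combination h0 - X 1 * he
    obtain ⟨p', hp'⟩ := dvd_sub_of_dvd_X_sub hX p
    obtain ⟨q', hq'⟩ := dvd_sub_of_dvd_X_sub hX q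
    exact ⟨e, p', q', by linear_combination hp' + he, by linear_combination hq' + hq⟩

/-- The linear forms that are the entries of the relations between the four syzygies. -/
def relForm : Fin 3 → S3 :=
  ![63 * (-34560 * X 0 + 471 * X 1 + 112 * X 2), 568576 * X 0 - 7803 * X 1 - 1296 * X 2,
    -37120 * X 0 + 513 * X 1 + 48 * X 2]

end LinearForms

section Frame

open Matrix

/-- The change of coordinates sending the variables to the linear forms `relForm`. -/
def relFormEquiv : S3 ≃ₐ[ℂ] S3 :=
  AlgEquiv.ofAlgHom (aeval relForm)
    (aeval ![C (-1 / 224) * X 0 + C (-121 / 3584) * X 1 + C (-915 / 3584) * X 2,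
      C (-121 / 378) * X 0 + C (-305 / 126) * X 1 + C (-1153 / 63) * X 2,
      C (-1 / 32) * X 0 + C (-5 / 21) * X 1 + C (-1219 / 672) * X 2])
    (by
      ext i : 1
      refine MvPolynomial.funext fun p => ?_
      fin_cases i <;>
      simp only [relForm, AlgHom.comp_apply, aeval_X, map_add, map_sub, map_mul, map_neg, map_ofNat,
        Fin.zero_eta, Fin.mk_one, Fin.reduceFinMk, cons_val, eval_X, eval_C, AlgHom.id_apply,
        algHom_C, algebraMap_eq] <;>
      ring)
    (by
      ext i : 1
      refine MvPolynomial.funext fun p => ?_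
      fin_cases i <;>
      simp only [relForm, AlgHom.comp_apply, aeval_X, map_add, map_sub, map_mul, map_neg, map_ofNat,
        Fin.zero_eta, Fin.mk_one, Fin.reduceFinMk, cons_val, eval_X, eval_C, AlgHom.id_apply] <;>
      ring)

theorem isKoszulTriple_relForm : IsKoszulTriple (relForm 0) (relForm 1) (relForm 2) := by
  simpa [relFormEquiv] using isKoszulTriple_X.map_ringEquiv relFormEquiv.toRingEquiv

/-- Three times `f0`. -/
def f0Int : S3 :=
  3 * X 0 ^ 6 * X 1 ^ 4 + 12 * X 0 ^ 5 * X 1 ^ 3 * X 2 ^ 2 + 9 * X 0 ^ 4 * X 1 ^ 3 * X 2 ^ 3 +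
    18 * X 0 ^ 4 * X 1 ^ 2 * X 2 ^ 4 + 19 * X 0 ^ 3 * X 1 ^ 2 * X 2 ^ 5 +
    12 * X 0 ^ 3 * X 1 * X 2 ^ 6 + 9 * X 0 ^ 2 * X 1 ^ 2 * X 2 ^ 6 +
    11 * X 0 ^ 2 * X 1 * X 2 ^ 7 + 3 * X 0 ^ 2 * X 2 ^ 8 + 6 * X 0 * X 1 * X 2 ^ 8 +
    X 0 * X 2 ^ 9 + 3 * X 1 * X 2 ^ 9 - 3 * X 2 ^ 10

theorem three_mul_f0 : 3 * f0 = f0Int := by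
  refine MvPolynomial.funext fun p => ?_
  simp [f0, f0Int]
  ring

/-- A multiple of the gradient of the curve `D₀`. -/
def gradVec (i : Fin 3) : S3 := 181440 * pderiv i D0curve

theorem gradVec_eq (i : Fin 3) : gradVec i = 60480 * pderiv i (X 0 * X 2 * hCubic * f0Int) := by
  rw [← three_mul_f0, show X 0 * X 2 * hCubic * (3 * f0) = (3 : ℕ) • D0curve by
    rw [D0curve, nsmul_eq_mul]; push_cast; ring, map_nsmul, gradVec, nsmul_eq_mul]
  push_cast
  ring

theorem mem_jacSyz_iff (w : Fin 3 → S3) : w ∈ jacSyz D0curve ↔ w ⬝ᵥ gradVec = 0 := by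
  have : w ⬝ᵥ gradVec = 181440 *
      (w 0 * pderiv 0 D0curve + w 1 * pderiv 1 D0curve + w 2 * pderiv 2 D0curve) := by
    simp only [dotProduct, Fin.sum_univ_three, gradVec]
    ring
  rw [this, mul_eq_zero, or_iff_right (by norm_num)]
  rfl

theorem pderiv_ofNat (i : Fin 3) (n : ℕ) [n.AtLeastTwo] :
    pderiv i (ofNat(n) : S3) = 0 :=
  Derivation.map_natCast _ n

theorem pderiv_zero_hCubic : pderiv 0 hCubic =
    98304 * X 0 ^ 2 - 1536 * X 0 * X 2 + 1824 * X 2 ^ 2 := by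
  simp [hCubic, pderiv_X, pderiv_ofNat]
  ring

theorem pderiv_one_hCubic : pderiv 1 hCubic = 0 := by
  simp [hCubic, pderiv_X, pderiv_ofNat]

theorem pderiv_two_hCubic : pderiv 2 hCubic =
    -768 * X 0 ^ 2 + 3648 * X 0 * X 2 - 729 * X 2 ^ 2 := by
  simp [hCubic, pderiv_X, pderiv_ofNat]
  ring

theorem pderiv_zero_f0Int : pderiv 0 f0Int =
    18 * X 0 ^ 5 * X 1 ^ 4 + 60 * X 0 ^ 4 * X 1 ^ 3 * X 2 ^ 2 + 36 * X 0 ^ 3 * X 1 ^ 3 * X 2 ^ 3 +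
    72 * X 0 ^ 3 * X 1 ^ 2 * X 2 ^ 4 + 57 * X 0 ^ 2 * X 1 ^ 2 * X 2 ^ 5 +
    36 * X 0 ^ 2 * X 1 * X 2 ^ 6 + 18 * X 0 * X 1 ^ 2 * X 2 ^ 6 +
    22 * X 0 * X 1 * X 2 ^ 7 + 6 * X 0 * X 2 ^ 8 + 6 * X 1 * X 2 ^ 8 + X 2 ^ 9 := by
  simp [f0Int, pderiv_X, pderiv_ofNat]
  ring

theorem pderiv_one_f0Int : pderiv 1 f0Int =
    12 * X 0 ^ 6 * X 1 ^ 3 + 36 * X 0 ^ 5 * X 1 ^ 2 * X 2 ^ 2 + 27 * X 0 ^ 4 * X 1 ^ 2 * X 2 ^ 3 +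
    36 * X 0 ^ 4 * X 1 * X 2 ^ 4 + 38 * X 0 ^ 3 * X 1 * X 2 ^ 5 +
    12 * X 0 ^ 3 * X 2 ^ 6 + 18 * X 0 ^ 2 * X 1 * X 2 ^ 6 +
    11 * X 0 ^ 2 * X 2 ^ 7 + 6 * X 0 * X 2 ^ 8 + 3 * X 2 ^ 9 := by
  simp [f0Int, pderiv_X, pderiv_ofNat]
  ring

theorem pderiv_two_f0Int : pderiv 2 f0Int =
    24 * X 0 ^ 5 * X 1 ^ 3 * X 2 + 27 * X 0 ^ 4 * X 1 ^ 3 * X 2 ^ 2 +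
    72 * X 0 ^ 4 * X 1 ^ 2 * X 2 ^ 3 + 95 * X 0 ^ 3 * X 1 ^ 2 * X 2 ^ 4 +
    72 * X 0 ^ 3 * X 1 * X 2 ^ 5 + 54 * X 0 ^ 2 * X 1 ^ 2 * X 2 ^ 5 +
    77 * X 0 ^ 2 * X 1 * X 2 ^ 6 + 24 * X 0 ^ 2 * X 2 ^ 7 + 48 * X 0 * X 1 * X 2 ^ 7 +
    9 * X 0 * X 2 ^ 8 + 27 * X 1 * X 2 ^ 8 - 30 * X 2 ^ 9 := by
  simp [f0Int, pderiv_X, pderiv_ofNat]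
  ring

theorem gradVec_zero : gradVec 0 = 60480 * (X 2 * (hCubic * f0Int +
    X 0 * (pderiv 0 hCubic * f0Int + hCubic * pderiv 0 f0Int))) := by
  simp [gradVec_eq, pderiv_X]
  ring

theorem gradVec_one : gradVec 1 = 60480 * (X 0 * X 2 * hCubic * pderiv 1 f0Int) := by
  simp [gradVec_eq, pderiv_X, pderiv_one_hCubic]

theorem gradVec_two : gradVec 2 = 60480 * (X 0 * (hCubic * f0Int +
    X 2 * (pderiv 2 hCubic * f0Int + hCubic * pderiv 2 f0Int))) := by
  simp [gradVec_eq, pderiv_X]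
  ring

/-- The four generators of the Jacobian syzygies of `D₀`. -/
def syzVec : Fin 4 → Fin 3 → S3 :=
  ![fun i => 8 * firstSyz i, fun i => 3 * secondSyz i, fun i => 3 * thirdSyz i,
    fun i => 24 * fourthSyz i]

set_option maxHeartbeats 4000000 in
theorem syzVec_rel_left :
    relForm 0 • syzVec 0 + relForm 1 • syzVec 1 + relForm 2 • syzVec 2 = 0 := by
  funext i
  fin_cases i <;>
  simp only [relForm, syzVec, firstSyz, secondSyz, thirdSyz, ofTerms, List.map, List.sum_cons,
    List.sum_nil, Fin.zero_eta, Fin.mk_one, Fin.reduceFinMk, cons_val, Pi.add_apply,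
    Pi.smul_apply, smul_eq_mul, Pi.zero_apply, Int.cast_ofNat, Int.cast_neg] <;>
  ring

set_option maxHeartbeats 4000000 in
theorem syzVec_rel_right :
    relForm 0 • syzVec 1 + relForm 1 • syzVec 2 + relForm 2 • syzVec 3 = 0 := by
  funext i
  fin_cases i <;>
  simp only [relForm, syzVec, secondSyz, thirdSyz, fourthSyz, ofTerms, List.map, List.sum_cons,
    List.sum_nil, Fin.zero_eta, Fin.mk_one, Fin.reduceFinMk, cons_val, Pi.add_apply,
    Pi.smul_apply, smul_eq_mul, Pi.zero_apply, Int.cast_ofNat, Int.cast_neg] <;>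
  ring

set_option maxHeartbeats 4000000 in
theorem syzVec_cross : syzVec 2 ⨯₃ syzVec 3 = relForm 0 ^ 2 • gradVec := by
  rw [cross_apply]
  funext i
  fin_cases i <;>
  simp only [Fin.zero_eta, Fin.mk_one, Fin.reduceFinMk, cons_val, Pi.smul_apply, smul_eq_mul,
    gradVec_zero, gradVec_one, gradVec_two, pderiv_zero_hCubic, pderiv_two_hCubic,
    pderiv_zero_f0Int, pderiv_one_f0Int, pderiv_two_f0Int] <;>
  simp only [relForm, syzVec, thirdSyz, fourthSyz, ofTerms, List.map, List.sum_cons,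
    List.sum_nil, cons_val, Int.cast_ofNat, Int.cast_neg, hCubic, f0Int] <;>
  ring

end Frame

section Primitive

/-- If `g • u` is a multiple of `G`, then `u` is already a multiple of `G`. -/
def IsCancellable {R : Type*} [CommRing R] (G : Fin 3 → R) (g : R) : Prop :=
  ∀ (u : Fin 3 → R) (p : R), g • u = p • G → ∃ p' : R, u = p' • G

theorem IsCancellable.mul {R : Type*} [CommRing R] {G : Fin 3 → R} {g g' : R}
    (h : IsCancellable G g) (h' : IsCancellable G g') : IsCancellable G (g * g') := by
  intro u p hu
  rw [mul_smul] at hu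
  obtain ⟨p', hp'⟩ := h _ _ hu
  exact h' _ _ hp'

theorem IsCancellable.pow {R : Type*} [CommRing R] {G : Fin 3 → R} {g : R}
    (h : IsCancellable G g) (n : ℕ) : IsCancellable G (g ^ n) := by
  induction n with
  | zero => exact fun u p hu => ⟨p, by simpa using hu⟩
  | succ n ih => exact pow_succ g n ▸ ih.mul h

theorem isCancellable_C (G : Fin 3 → S3) {k : ℂ} (hk : k ≠ 0) : IsCancellable G (C k) := by
  intro u p hu
  refine ⟨C k⁻¹ * p, ?_⟩
  rw [mul_smul, ← hu, smul_smul, ← C_mul, inv_mul_cancel₀ hk, C_1, one_smul]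

/-- A linear form that cuts out a line on which `G` does not vanish identically is cancellable. -/
theorem isCancellable_of_eval_ne_zero {G : Fin 3 → S3} {l : S3} {σ : S3 →ₐ[ℂ] S3}
    (hl : l ≠ 0) (hσl : σ l = 0) (hσ : ∀ i, l ∣ X i - σ (X i)) (P : Fin 3 → ℂ)
    (hP : eval P l = 0) (j : Fin 3) (hG : eval P (G j) ≠ 0) : IsCancellable G l := by
  intro u p hu
  have hσG : σ (G j) ≠ 0 := by
    intro h0
    obtain ⟨q, hq⟩ := dvd_sub_of_dvd_X_sub hσ (G j)
    apply hG
    rw [h0, sub_zero] at hq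
    rw [hq, map_mul, hP, zero_mul]
  have hp : σ p = 0 := by
    have := congrArg σ (congrFun hu j)
    simpa [hσl, hσG] using this
  obtain ⟨q, hq⟩ := dvd_sub_of_dvd_X_sub hσ p
  rw [hp, sub_zero] at hq
  refine ⟨q, smul_right_injective _ hl ?_⟩
  simp only [hu, hq, mul_smul]

theorem isCancellable_X_sub {G : Fin 3 → S3} (r y : ℂ) (hG : eval ![r, y, 1] (G 0) ≠ 0) :
    IsCancellable G (X 0 - C r * X 2) := by
  refine isCancellable_of_eval_ne_zero (σ := aeval ![C r * X 2, X 1, X 2]) ?_ ?_ ?_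
    ![r, y, 1] ?_ 0 hG
  · intro h
    simpa using congrArg (eval ![1, 0, 0]) h
  · simp [algHom_C]
  · intro i
    fin_cases i <;> simp
  · simp

theorem isCancellable_X_zero : IsCancellable gradVec (X 0) := by
  have := isCancellable_X_sub (G := gradVec) 0 0
    (by simp [gradVec_zero, hCubic, f0Int])
  simpa using this

theorem isCancellable_X_two : IsCancellable gradVec (X 2) := by
  refine isCancellable_of_eval_ne_zero (σ := aeval ![X 0, X 1, 0]) (X_ne_zero 2) (by simp) ?_
    ![1, 1, 0] (by simp) 2 (by simp [gradVec_two, hCubic, f0Int])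
  intro i
  fin_cases i <;> simp

theorem isCancellable_of_root {r : ℂ} (hr : 32768 * r ^ 3 - 768 * r ^ 2 + 1824 * r - 243 = 0) :
    IsCancellable gradVec (X 0 - C r * X 2) := by
  have hr0 : r ≠ 0 := by
    rintro rfl
    norm_num at hr
  have hr1 : 98304 * r ^ 2 - 1536 * r + 1824 ≠ 0 := by
    intro h
    have : (-1861632 * r - 336864) * (32768 * r ^ 3 - 768 * r ^ 2 + 1824 * r - 243) +
      (620544 * r ^ 2 + 107440 * r + 22075) * (98304 * r ^ 2 - 1536 * r + 1824) = 122122752 := by ring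
    rw [hr, h] at this
    norm_num at this
  obtain ⟨y, hy⟩ : ∃ y : ℂ, eval ![r, y, 1] f0Int ≠ 0 := by
    by_contra! h
    have h0 := h 0
    have h1 := h 1
    have h2 := h 2
    have h3 := h 3
    have h4 := h 4
    simp [f0Int] at h0 h1 h2 h3 h4
    apply pow_ne_zero 6 hr0
    linear_combination (h4 - 4 * h3 + 6 * h2 - 4 * h1 + h0) / 72
  refine isCancellable_X_sub r y ?_
  have hh : eval ![r, y, 1] hCubic = 0 := by
    simp [hCubic]
    linear_combination hr
  have hh' : eval ![r, y, 1] (pderiv 0 hCubic) ≠ 0 := by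
    convert hr1
    simp [pderiv_zero_hCubic]
  rw [gradVec_zero]
  simp [hh, hh', hy, hr0]

theorem exists_factorization_hCubic : ∃ r : Fin 3 → ℂ,
    (∀ i, 32768 * r i ^ 3 - 768 * r i ^ 2 + 1824 * r i - 243 = 0) ∧
    hCubic = C 32768 * ((X 0 - C (r 0) * X 2) * (X 0 - C (r 1) * X 2) * (X 0 - C (r 2) * X 2)) := by
  obtain ⟨a, ha⟩ := IsAlgClosed.exists_root
    (Polynomial.C 32768 * Polynomial.X ^ 3 + Polynomial.C (-768) * Polynomial.X ^ 2 +
      Polynomial.C 1824 * Polynomial.X + Polynomial.C (-243) : Polynomial ℂ)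
    (by rw [Polynomial.degree_cubic (by norm_num)]; norm_num)
  obtain ⟨b, hb⟩ := IsAlgClosed.exists_root
    (Polynomial.C 32768 * Polynomial.X ^ 2 + Polynomial.C (32768 * a - 768) * Polynomial.X +
      Polynomial.C (32768 * a ^ 2 - 768 * a + 1824) : Polynomial ℂ)
    (by rw [Polynomial.degree_quadratic (by norm_num)]; norm_num)
  simp only [Polynomial.IsRoot.def, Polynomial.eval_add, Polynomial.eval_mul, Polynomial.eval_C,
    Polynomial.eval_pow, Polynomial.eval_X] at ha hb
  have hfac (x z : ℂ) : 32768 * x ^ 3 - 768 * x ^ 2 * z + 1824 * x * z ^ 2 - 243 * z ^ 3 =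
      32768 * ((x - a * z) * (x - b * z) * (x - (768 / 32768 - a - b) * z)) := by
    linear_combination z ^ 3 * ha + z ^ 2 * (x - a * z) * hb
  refine ⟨![a, b, 768 / 32768 - a - b], ?_, ?_⟩
  · intro i
    have := fun x => hfac x 1
    simp only [mul_one, one_pow] at this
    rw [this]
    fin_cases i <;> simp
  · refine MvPolynomial.funext fun p => ?_
    simpa [hCubic] using hfac (p 0) (p 2)

theorem isCancellable_hCubic : IsCancellable gradVec hCubic := by
  obtain ⟨r, hr, h⟩ := exists_factorization_hCubic
  rw [h]
  exact (isCancellable_C _ (by norm_num)).mul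
    (((isCancellable_of_root (hr 0)).mul (isCancellable_of_root (hr 1))).mul
      (isCancellable_of_root (hr 2)))

/-- The first Bézout coefficient of `f0` and its derivative with respect to `y`. -/
def bezoutLeft : S3 :=
  243 * X 2 ^ 9 + 405 * X 0 * X 2 ^ 8 + 675 * X 0 ^ 2 * X 2 ^ 7 + 1458 * X 0 ^ 2 * X 1 * X 2 ^ 6 -
    37188 * X 0 ^ 3 * X 2 ^ 6 + 2430 * X 0 ^ 3 * X 1 * X 2 ^ 5 - 15104 * X 0 ^ 4 * X 2 ^ 5 -
    8892 * X 0 ^ 4 * X 1 * X 2 ^ 4 + 2187 * X 0 ^ 4 * X 1 ^ 2 * X 2 ^ 3 -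
    49152 * X 0 ^ 5 * X 2 ^ 4 - 87552 * X 0 ^ 5 * X 1 * X 2 ^ 3 +
    1620 * X 0 ^ 5 * X 1 ^ 2 * X 2 ^ 2 - 98304 * X 0 ^ 6 * X 1 * X 2 ^ 2 -
    6912 * X 0 ^ 6 * X 1 ^ 2 * X 2 + 972 * X 0 ^ 6 * X 1 ^ 3 - 49152 * X 0 ^ 7 * X 1 ^ 2

/-- The second Bézout coefficient of `f0` and its derivative with respect to `y`. -/
def bezoutRight : S3 :=
  -243 * X 1 * X 2 ^ 9 + 2148 * X 0 * X 2 ^ 9 - 405 * X 0 * X 1 * X 2 ^ 8 -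
    4767 * X 0 ^ 2 * X 2 ^ 8 + 783 * X 0 ^ 2 * X 1 * X 2 ^ 7 - 729 * X 0 ^ 2 * X 1 ^ 2 * X 2 ^ 6 -
    3392 * X 0 ^ 3 * X 2 ^ 7 + 23328 * X 0 ^ 3 * X 1 * X 2 ^ 6 -
    1134 * X 0 ^ 3 * X 1 ^ 2 * X 2 ^ 5 + 12288 * X 0 ^ 4 * X 2 ^ 6 +
    27712 * X 0 ^ 4 * X 1 * X 2 ^ 5 + 3114 * X 0 ^ 4 * X 1 ^ 2 * X 2 ^ 4 -
    729 * X 0 ^ 4 * X 1 ^ 3 * X 2 ^ 3 + 36864 * X 0 ^ 5 * X 1 * X 2 ^ 4 +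
    32832 * X 0 ^ 5 * X 1 ^ 2 * X 2 ^ 3 - 648 * X 0 ^ 5 * X 1 ^ 3 * X 2 ^ 2 +
    36864 * X 0 ^ 6 * X 1 ^ 2 * X 2 ^ 2 + 1728 * X 0 ^ 6 * X 1 ^ 3 * X 2 -
    243 * X 0 ^ 6 * X 1 ^ 4 + 12288 * X 0 ^ 7 * X 1 ^ 3

theorem bezout_f0Int :
    bezoutLeft * f0Int + bezoutRight * pderiv 1 f0Int = 3 * X 2 ^ 16 * hCubic := by
  rw [pderiv_one_f0Int]
  simp only [bezoutLeft, bezoutRight, f0Int, hCubic]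
  ring

theorem euler_gradVec : X 0 * gradVec 0 + X 1 * gradVec 1 + X 2 * gradVec 2 =
    907200 * (X 0 * X 2 * hCubic * f0Int) := by
  rw [gradVec_zero, gradVec_one, gradVec_two, pderiv_zero_hCubic, pderiv_two_hCubic,
    pderiv_zero_f0Int, pderiv_one_f0Int, pderiv_two_f0Int]
  simp only [f0Int, hCubic]
  ring

theorem isPrimitiveVec_gradVec : IsPrimitiveVec gradVec := by
  intro u hu
  have hg : IsCancellable gradVec (C 2721600 * (X 0 * X 2 ^ 17 * hCubic ^ 2)) :=
    (isCancellable_C _ (by norm_num)).mul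
      ((isCancellable_X_zero.mul (isCancellable_X_two.pow 17)).mul (isCancellable_hCubic.pow 2))
  refine hg u (bezoutLeft * (X 0 * u 0 + X 1 * u 1 + X 2 * u 2) + 15 * bezoutRight * u 1) ?_
  have key : C 2721600 * (X 0 * X 2 ^ 17 * hCubic ^ 2) =
      bezoutLeft * (X 0 * gradVec 0 + X 1 * gradVec 1 + X 2 * gradVec 2) +
        15 * bezoutRight * gradVec 1 := by
    rw [euler_gradVec, gradVec_one, show (C 2721600 : S3) = 2721600 from map_ofNat C 2721600]
    linear_combination -907200 * (X 0 * X 2 * hCubic) * bezout_f0Int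
  funext i
  simp only [Pi.smul_apply, smul_eq_mul, key]
  linear_combination (bezoutLeft * X 0) * hu i 0 + (bezoutLeft * X 1 + 15 * bezoutRight) * hu i 1 +
    (bezoutLeft * X 2) * hu i 2

theorem isSyzygyFrame_syzVec :
    IsSyzygyFrame (relForm 0) (relForm 1) (relForm 2) gradVec syzVec where
  koszul := isKoszulTriple_relForm
  ne_zero h := by
    have := congrArg (eval ![0, 0, 1]) (congrFun h 0)
    simp [gradVec_zero, hCubic, f0Int] at this
  primitive := isPrimitiveVec_gradVec
  rel_left := syzVec_rel_left
  rel_right := syzVec_rel_right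
  cross_eq := syzVec_cross

end Primitive

section Generators

theorem isHomogeneous_ofTerms {l : List (ℤ × ℕ × ℕ × ℕ)} {n : ℕ}
    (h : ∀ t ∈ l, t.2.1 + t.2.2.1 + t.2.2.2 = n) : (ofTerms l).IsHomogeneous n := by
  induction l with
  | nil => exact isHomogeneous_zero _ _ _
  | cons t l ih =>
    rw [ofTerms, List.map_cons, List.sum_cons]
    refine IsHomogeneous.add ?_ (ih fun t ht => h t (List.mem_cons_of_mem _ ht))
    rw [← h t List.mem_cons_self, show (t.1 : S3) = C (t.1 : ℂ) from
      (map_intCast (C : ℂ →+* S3) t.1).symm]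
    exact (((isHomogeneous_X_pow 0 _).C_mul _).mul (isHomogeneous_X_pow 1 _)).mul
      (isHomogeneous_X_pow 2 _)

theorem isHomogeneous_syzVec (j : Fin 4) (i : Fin 3) : (syzVec j i).IsHomogeneous 8 := by
  have h (n : ℕ) {p : S3} (hp : p.IsHomogeneous 8) : ((n : S3) * p).IsHomogeneous 8 := by
    rw [← map_natCast (C : ℂ →+* S3)]
    exact hp.C_mul _
  fin_cases j
  · refine h 8 ?_
    fin_cases i <;> exact isHomogeneous_ofTerms (by decide)
  · refine h 3 ?_
    fin_cases i <;> exact isHomogeneous_ofTerms (by decide)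
  · refine h 3 ?_
    fin_cases i <;> exact isHomogeneous_ofTerms (by decide)
  · refine h 24 ?_
    fin_cases i <;> exact isHomogeneous_ofTerms (by decide)

theorem constantCoeff_eq_zero_of_relation {r : Fin 4 → S3} (hr : ∑ j, r j • syzVec j = 0)
    (j : Fin 4) : constantCoeff (r j) = 0 := by
  obtain ⟨s, t, h0, h1, h2, h3⟩ := isSyzygyFrame_syzVec.exists_of_relation r hr
  fin_cases j <;> simp [h0, h1, h2, h3, relForm]

theorem span_syzVec : Submodule.span S3 (Set.range syzVec) = jacSyz D0curve := by
  apply le_antisymm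
  · rw [Submodule.span_le]
    rintro _ ⟨j, rfl⟩
    exact (mem_jacSyz_iff _).mpr (isSyzygyFrame_syzVec.dotProduct_eq_zero j)
  · exact fun w hw => isSyzygyFrame_syzVec.mem_span ((mem_jacSyz_iff w).mp hw)

theorem exists_eq_sum_syzVec {w : Fin 3 → S3} (hw : w ∈ jacSyz D0curve) :
    ∃ c : Fin 4 → S3, ∑ j, c j • syzVec j = w := by
  rwa [← span_syzVec, Submodule.mem_span_range_iff_exists_fun] at hw

theorem syzVec_notMem_span (j : Fin 4) :
    syzVec j ∉ Submodule.span S3 (syzVec '' {j' | j' ≠ j}) := by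
  rw [Finsupp.mem_span_image_iff_linearCombination]
  rintro ⟨c, hc, h⟩
  rw [Finsupp.linearCombination_apply, Finsupp.sum_fintype _ _ (by simp)] at h
  have hcj : c j = 0 := by
    rw [Finsupp.mem_supported] at hc
    by_contra h0
    exact hc (Finsupp.mem_support_iff.mpr h0) rfl
  have hr : ∑ k, (c k - Pi.single (M := fun _ => S3) j 1 k) • syzVec k = 0 := by
    simp [sub_smul, Finset.sum_sub_distrib, Pi.single_apply, h]
  simpa [hcj] using constantCoeff_eq_zero_of_relation hr j

theorem syzVec_ne_zero (j : Fin 4) : syzVec j ≠ 0 := fun h =>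
  syzVec_notMem_span j (h ▸ zero_mem _)

theorem isMinGenSyz_syzVec : IsMinGenSyz D0curve 4 (fun _ => 8) syzVec where
  mem j := span_syzVec ▸ Submodule.subset_span ⟨j, rfl⟩
  hom := isHomogeneous_syzVec
  ne_zero := syzVec_ne_zero
  span_eq := span_syzVec
  minimal := syzVec_notMem_span
  mono := monotone_const

theorem four_le_of_span_eq {m : ℕ} {w : Fin m → Fin 3 → S3}
    (hw : Submodule.span S3 (Set.range w) = jacSyz D0curve) : 4 ≤ m := by
  have hA (j : Fin 4) : ∃ c : Fin m → S3, ∑ k, c k • w k = syzVec j := by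
    rw [← Submodule.mem_span_range_iff_exists_fun, hw]
    exact isMinGenSyz_syzVec.mem j
  choose A hA using hA
  choose B hB using fun k => exists_eq_sum_syzVec (hw ▸ Submodule.subset_span ⟨k, rfl⟩ : w k ∈ _)
  have hAB : Matrix.of (fun j k => constantCoeff (A j k)) *
      Matrix.of (fun k j => constantCoeff (B k j)) = (1 : Matrix (Fin 4) (Fin 4) ℂ) := by
    ext i j
    have hr : ∑ l, (∑ k, A i k * B k l - Pi.single (M := fun _ => S3) i 1 l) • syzVec l = 0 := by
      simp only [sub_smul, Finset.sum_sub_distrib, Finset.sum_smul, mul_smul]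
      rw [Finset.sum_comm]
      simp [← Finset.smul_sum, hB, hA, Pi.single_apply]
    have := constantCoeff_eq_zero_of_relation hr j
    simp only [map_sub, map_sum, map_mul, sub_eq_zero] at this
    rw [Matrix.mul_apply]
    simp only [Matrix.of_apply, this, Matrix.one_apply, Pi.single_apply, eq_comm]
    split_ifs <;> simp
  have h1 := Matrix.rank_mul_le_left (Matrix.of fun j k => constantCoeff (A j k))
    (Matrix.of fun k j => constantCoeff (B k j))
  have h2 := Matrix.rank_le_width (Matrix.of fun j k => constantCoeff (A j k))
  rw [hAB, Matrix.rank_one, Fintype.card_fin] at h1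
  exact h1.trans h2

theorem not_isFreeCurve_D0curve : ¬ IsFreeCurve D0curve := by
  rintro ⟨d₁, d₂, w, hw⟩
  have := four_le_of_span_eq hw.span_eq
  omega

theorem homogeneousComponent_mul_right {n k : ℕ} (p : S3) {q : S3} (hq : q.IsHomogeneous n)
    (h : n ≤ k) : homogeneousComponent k (p * q) = homogeneousComponent (k - n) p * q := by
  let _ := gradedAlgebra (σ := Fin 3) (R := ℂ)
  simp only [← decomposition.decompose'_apply]
  exact DirectSum.coe_decompose_mul_of_right_mem_of_le (homogeneousSubmodule (Fin 3) ℂ) (a := p)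
      ((mem_homogeneousSubmodule n q).mpr hq) h

theorem homogeneousComponent_mul_right_of_lt {n k : ℕ} (p : S3) {q : S3} (hq : q.IsHomogeneous n)
    (h : k < n) : homogeneousComponent k (p * q) = 0 := by
  let _ := gradedAlgebra (σ := Fin 3) (R := ℂ)
  simp only [← decomposition.decompose'_apply]
  exact DirectSum.coe_decompose_mul_of_right_mem_of_not_le (homogeneousSubmodule (Fin 3) ℂ) (a := p)
      ((mem_homogeneousSubmodule n q).mpr hq) h.not_ge

theorem isMDR_D0curve : IsMDR D0curve 8 := by
  refine ⟨⟨syzVec 0, isMinGenSyz_syzVec.mem 0, syzVec_ne_zero 0, isHomogeneous_syzVec 0⟩, ?_⟩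
  intro m hm w hw hom
  obtain ⟨c, rfl⟩ := exists_eq_sum_syzVec hw
  funext i
  rw [← homogeneousComponent_eq_self (hom i)]
  simp [homogeneousComponent_mul_right_of_lt _ (isHomogeneous_syzVec _ i) hm]

end Generators

section Tjurina

instance (n : ℕ) : Module.Finite ℂ (homogeneousSubmodule (Fin 3) ℂ n) :=
  Module.Finite.iff_fg.mpr (homogeneousSubmodule_fg (Fin 3) ℂ n)

theorem finrank_homogeneousSubmodule (n : ℕ) :
    Module.finrank ℂ (homogeneousSubmodule (Fin 3) ℂ n) = (n + 2).choose 2 := by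
  rw [homogeneousSubmodule_eq_finsupp_supported,
    (AddMonoidAlgebra.supportedEquivFinsupp (R := ℂ) (S := ℂ) _).finrank_eq]
  have hs : {d : Fin 3 →₀ ℕ | d.degree = n} =
      ((Finset.univ : Finset (Fin 3)).finsuppAntidiag n : Set (Fin 3 →₀ ℕ)) := by
    ext d
    simp [Finsupp.degree_eq_sum]
  rw [hs, Module.finrank_finsupp_self]
  simp only [SetLike.coe_sort_coe, Fintype.card_coe]
  rw [Finset.card_finsuppAntidiag_nat_eq_choose, Finset.card_univ, Fintype.card_fin,
    show 3 + n - 1 = n + 2 by omega, Nat.choose_symm_add]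

/-- Multiplication by a matrix of forms of degree `d`, on tuples of forms of degree `n`. -/
def gradedMap {a b d n e : ℕ} (M : Fin a → Fin b → S3) (hM : ∀ j i, (M j i).IsHomogeneous d)
    (he : n + d = e) : (Fin a → homogeneousSubmodule (Fin 3) ℂ n) →ₗ[ℂ]
      (Fin b → homogeneousSubmodule (Fin 3) ℂ e) where
  toFun c i := ⟨∑ j, (c j : S3) * M j i,
    sum_mem fun j _ => he ▸ IsHomogeneous.mul (c j).2 (hM j i)⟩
  map_add' c c' := by
    funext i
    ext1
    simp [add_mul, Finset.sum_add_distrib]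
  map_smul' k c := by
    funext i
    ext1
    simp [Finset.smul_sum]

theorem coe_gradedMap {a b d n e : ℕ} (M : Fin a → Fin b → S3)
    (hM : ∀ j i, (M j i).IsHomogeneous d) (he : n + d = e)
    (c : Fin a → homogeneousSubmodule (Fin 3) ℂ n) (i : Fin b) :
    (gradedMap M hM he c i : S3) = ∑ j, (c j : S3) * M j i := rfl

/-- If a tuple of forms is a combination of the rows of a homogeneous matrix, then it is
a combination with homogeneous coefficients. -/
theorem mem_range_gradedMap {a b d n e : ℕ} {M : Fin a → Fin b → S3}
    {hM : ∀ j i, (M j i).IsHomogeneous d} {he : n + d = e}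
    {w : Fin b → homogeneousSubmodule (Fin 3) ℂ e} :
    w ∈ LinearMap.range (gradedMap M hM he) ↔
      ∃ s : Fin a → S3, ∀ i, (w i : S3) = ∑ j, s j * M j i := by
  constructor
  · rintro ⟨c, rfl⟩
    exact ⟨fun j => c j, fun i => rfl⟩
  · rintro ⟨s, hs⟩
    refine ⟨fun j => ⟨homogeneousComponent n (s j), homogeneousComponent_mem n (s j)⟩, ?_⟩
    funext i
    ext1
    rw [coe_gradedMap, ← homogeneousComponent_eq_self (w i).2, hs, map_sum]
    refine Finset.sum_congr rfl fun j _ => ?_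
    rw [homogeneousComponent_mul_right _ (hM j i) (by omega), ← he, Nat.add_sub_cancel]

theorem mem_ker_gradedMap {a b d n e : ℕ} {M : Fin a → Fin b → S3}
    {hM : ∀ j i, (M j i).IsHomogeneous d} {he : n + d = e}
    {c : Fin a → homogeneousSubmodule (Fin 3) ℂ n} :
    c ∈ LinearMap.ker (gradedMap M hM he) ↔ ∀ i, ∑ j, (c j : S3) * M j i = 0 := by
  simp [LinearMap.mem_ker, funext_iff, Subtype.ext_iff, coe_gradedMap]

theorem finrank_range_gradedMap_add {a b d n e : ℕ} (M : Fin a → Fin b → S3)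
    (hM : ∀ j i, (M j i).IsHomogeneous d) (he : n + d = e) :
    Module.finrank ℂ (LinearMap.range (gradedMap M hM he)) +
      Module.finrank ℂ (LinearMap.ker (gradedMap M hM he)) = a * (n + 2).choose 2 := by
  rw [LinearMap.finrank_range_add_finrank_ker, Module.finrank_pi_fintype]
  simp [finrank_homogeneousSubmodule]

theorem isHomogeneous_relForm (i : Fin 3) : (relForm i).IsHomogeneous 1 := by
  have h : relForm = ![ofTerms [(-2177280, 1, 0, 0), (29673, 0, 1, 0), (7056, 0, 0, 1)],
      ofTerms [(568576, 1, 0, 0), (-7803, 0, 1, 0), (-1296, 0, 0, 1)],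
      ofTerms [(-37120, 1, 0, 0), (513, 0, 1, 0), (48, 0, 0, 1)]] := by
    funext i
    fin_cases i <;> simp [relForm, ofTerms] <;> ring
  rw [h]
  fin_cases i <;> exact isHomogeneous_ofTerms (by decide)

theorem isHomogeneous_hCubic : hCubic.IsHomogeneous 3 := by
  have h : hCubic = ofTerms
      [(32768, 3, 0, 0), (-768, 2, 0, 1), (1824, 1, 0, 2), (-243, 0, 0, 3)] := by
    simp [hCubic, ofTerms]
    ring
  exact h ▸ isHomogeneous_ofTerms (by decide)

theorem isHomogeneous_f0Int : f0Int.IsHomogeneous 10 := by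
  have h : f0Int = ofTerms [(3, 6, 4, 0), (12, 5, 3, 2), (9, 4, 3, 3), (18, 4, 2, 4), (19, 3, 2, 5),
      (12, 3, 1, 6), (9, 2, 2, 6), (11, 2, 1, 7), (3, 2, 0, 8), (6, 1, 1, 8), (1, 1, 0, 9),
      (3, 0, 1, 9), (-3, 0, 0, 10)] := by
    simp [f0Int, ofTerms]
    ring
  exact h ▸ isHomogeneous_ofTerms (by decide)

theorem isHomogeneous_gradVec (i : Fin 3) : (gradVec i).IsHomogeneous 14 := by
  rw [gradVec_eq, ← map_ofNat (C : ℂ →+* S3) 60480]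
  exact (((((isHomogeneous_X ℂ 0).mul (isHomogeneous_X ℂ 2)).mul isHomogeneous_hCubic).mul
    isHomogeneous_f0Int).pderiv (n := 15)).C_mul _

/-- The matrix of the two relations among the generators `syzVec`. -/
def relMatrix : Fin 2 → Fin 4 → S3 :=
  ![![relForm 0, relForm 1, relForm 2, 0], ![0, relForm 0, relForm 1, relForm 2]]

theorem isHomogeneous_relMatrix (j : Fin 2) (i : Fin 4) : (relMatrix j i).IsHomogeneous 1 := by
  fin_cases j <;> fin_cases i <;> simp [relMatrix, isHomogeneous_relForm, isHomogeneous_zero]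

theorem sum_mul_syzVec_eq_zero_iff (r : Fin 4 → S3) :
    (∀ i, ∑ j, r j * syzVec j i = 0) ↔ ∃ s : Fin 2 → S3, ∀ j, r j = ∑ k, s k * relMatrix k j := by
  have hr : (∀ i, ∑ j, r j * syzVec j i = 0) ↔ ∑ j, r j • syzVec j = 0 := by
    simp [funext_iff]
  rw [hr]
  constructor
  · intro h
    obtain ⟨s, t, h0, h1, h2, h3⟩ := isSyzygyFrame_syzVec.exists_of_relation r h
    refine ⟨![s, t], fun j => ?_⟩
    fin_cases j <;> simp [relMatrix, h0, h1, h2, h3, mul_comm]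
  · rintro ⟨s, hs⟩
    simp only [Fin.sum_univ_four, hs, Fin.sum_univ_two, relMatrix, Matrix.cons_val]
    linear_combination (norm := module) s 0 • syzVec_rel_left + s 1 • syzVec_rel_right

theorem sum_mul_gradVec_eq_zero_iff (w : Fin 3 → S3) :
    ∑ i, w i * gradVec i = 0 ↔ ∃ c : Fin 4 → S3, ∀ i, w i = ∑ j, c j * syzVec j i := by
  rw [← dotProduct, ← mem_jacSyz_iff, ← span_syzVec, Submodule.mem_span_range_iff_exists_fun]
  simp [funext_iff, eq_comm]

theorem mem_jacobianIdeal_iff (p : S3) :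
    p ∈ jacobianIdeal D0curve ↔ ∃ w : Fin 3 → S3, p = ∑ i, w i * gradVec i := by
  have hC : (181440 : S3) * C (1 / 181440) = 1 := by
    rw [← map_ofNat (C : ℂ →+* S3) 181440, ← C_mul]
    norm_num
  rw [jacobianIdeal, Submodule.mem_span_triple]
  simp only [Fin.sum_univ_three, gradVec, smul_eq_mul]
  constructor
  · rintro ⟨a, b, c, rfl⟩
    refine ⟨![C (1 / 181440) * a, C (1 / 181440) * b, C (1 / 181440) * c], ?_⟩
    simp only [Matrix.cons_val]
    linear_combination
      (-a * pderiv 0 D0curve - b * pderiv 1 D0curve - c * pderiv 2 D0curve) * hC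
  · rintro ⟨w, rfl⟩
    exact ⟨181440 * w 0, 181440 * w 1, 181440 * w 2, by ring⟩

theorem milnorDim_D0curve_add (l : ℕ) : milnorDim D0curve (l + 23) +
    3 * (l + 11).choose 2 + 2 * (l + 2).choose 2 = (l + 25).choose 2 + 4 * (l + 3).choose 2 := by
  set f₃ := gradedMap relMatrix isHomogeneous_relMatrix (rfl : l + 1 = l + 1)
  set f₂ := gradedMap syzVec isHomogeneous_syzVec (rfl : l + 1 + 8 = l + 1 + 8)
  set f₁ := gradedMap (n := l + 1 + 8) (e := l + 23) (fun i (_ : Fin 1) => gradVec i)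
    (fun i _ => isHomogeneous_gradVec i) (by omega)
  have ker₃ : LinearMap.ker f₃ = ⊥ := by
    rw [LinearMap.ker_eq_bot']
    intro s hs
    rw [← LinearMap.mem_ker, mem_ker_gradedMap] at hs
    have ha := isKoszulTriple_relForm.ne_zero
    have h0 : (s 0 : S3) = 0 := by
      simpa [relMatrix, ha] using hs 0
    have h1 : (s 1 : S3) = 0 := by
      simpa [relMatrix, ha, h0] using hs 1
    funext k
    ext1
    fin_cases k
    · exact h0
    · exact h1
  have ker₂ : LinearMap.ker f₂ = LinearMap.range f₃ := by
    ext c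
    rw [mem_ker_gradedMap, mem_range_gradedMap, sum_mul_syzVec_eq_zero_iff]
  have ker₁ : LinearMap.ker f₁ = LinearMap.range f₂ := by
    ext c
    rw [mem_ker_gradedMap, mem_range_gradedMap, ← sum_mul_gradVec_eq_zero_iff]
    simp
  have range₁ : Submodule.comap (homogeneousSubmodule (Fin 3) ℂ (l + 23)).subtype
      (Submodule.restrictScalars ℂ (jacobianIdeal D0curve)) =
      (LinearMap.range f₁).map (LinearEquiv.funUnique (Fin 1) ℂ
        (homogeneousSubmodule (Fin 3) ℂ (l + 23)) : _ →ₗ[ℂ] _) := by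
    ext p
    rw [Submodule.mem_map_equiv, mem_range_gradedMap]
    simp [mem_jacobianIdeal_iff]
  have e := Submodule.finrank_quotient_add_finrank
    (Submodule.comap (homogeneousSubmodule (Fin 3) ℂ (l + 23)).subtype
      (Submodule.restrictScalars ℂ (jacobianIdeal D0curve)))
  rw [finrank_homogeneousSubmodule, range₁, LinearEquiv.finrank_map_eq, ← range₁] at e
  have e₁ : Module.finrank ℂ (LinearMap.range f₁) + Module.finrank ℂ (LinearMap.ker f₁) = _ :=
    finrank_range_gradedMap_add _ _ _
  have e₂ : Module.finrank ℂ (LinearMap.range f₂) + Module.finrank ℂ (LinearMap.ker f₂) = _ :=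
    finrank_range_gradedMap_add _ _ _
  have e₃ : Module.finrank ℂ (LinearMap.range f₃) + Module.finrank ℂ (LinearMap.ker f₃) = _ :=
    finrank_range_gradedMap_add _ _ _
  rw [ker₁] at e₁
  rw [ker₂] at e₂
  rw [ker₃, finrank_bot] at e₃
  rw [milnorDim]
  simp only [add_assoc, Nat.reduceAdd] at e e₁ e₂ e₃ ⊢
  omega

theorem isTjurina_D0curve : IsTjurina D0curve 145 := by
  rw [IsTjurina, Filter.eventually_atTop]
  refine ⟨23, fun k hk => ?_⟩
  obtain ⟨l, rfl⟩ := Nat.exists_eq_add_of_le' hk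
  have h := milnorDim_D0curve_add l
  have hc (m : ℕ) : ((m + 1).choose 2 : ℚ) = (m + 1) * m / 2 := by
    rw [Nat.cast_choose_two]
    push_cast
    ring
  have hq : (milnorDim D0curve (l + 23) : ℚ) + 3 * (l + 11).choose 2 + 2 * (l + 2).choose 2 =
      (l + 25).choose 2 + 4 * (l + 3).choose 2 := by exact_mod_cast h
  rw [hc (l + 10), hc (l + 1), hc (l + 24), hc (l + 2)] at hq
  push_cast at hq
  have : (milnorDim D0curve (l + 23) : ℚ) = 145 := by linear_combination hq
  exact_mod_cast this

theorem isMaxTjurina_D0curve : IsMaxTjurina D0curve 15 8 :=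
  ⟨isMDR_D0curve, by norm_num, 145, isTjurina_D0curve, by norm_num [Nat.choose]⟩

end Tjurina

section ModularPoint

theorem restrictToLine_D0curve (c : ℂ) (w : Fin 3 → ℂ) : ∃ Q : Polynomial ℂ,
    restrictToLine D0curve ![0, c, 0] w = Polynomial.X ^ 11 * Q ∧
    Q.eval 0 = w 0 * w 2 * (eval w hCubic * (w 0 ^ 6 * c ^ 4)) := by
  let x := Polynomial.C (w 0)
  let y := Polynomial.C c + Polynomial.X * Polynomial.C (w 1)
  let z := Polynomial.C (w 2)
  let t : Polynomial ℂ := Polynomial.X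
  refine ⟨x * z * (32768 * x ^ 3 - 768 * x ^ 2 * z + 1824 * x * z ^ 2 - 243 * z ^ 3) *
    (x ^ 6 * y ^ 4 + 4 * x ^ 5 * y ^ 3 * z ^ 2 * t + 3 * x ^ 4 * y ^ 3 * z ^ 3 * t +
    6 * x ^ 4 * y ^ 2 * z ^ 4 * t ^ 2 + Polynomial.C (19 / 3) * x ^ 3 * y ^ 2 * z ^ 5 * t ^ 2 +
    4 * x ^ 3 * y * z ^ 6 * t ^ 3 + 3 * x ^ 2 * y ^ 2 * z ^ 6 * t ^ 2 +
    Polynomial.C (11 / 3) * x ^ 2 * y * z ^ 7 * t ^ 3 + x ^ 2 * z ^ 8 * t ^ 4 +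
    2 * x * y * z ^ 8 * t ^ 3 + Polynomial.C (1 / 3) * x * z ^ 9 * t ^ 4 + y * z ^ 9 * t ^ 3 -
    z ^ 10 * t ^ 4), ?_, ?_⟩
  · simp only [restrictToLine, D0curve, hCubic, f0, map_add, map_sub, map_mul, map_pow, map_ofNat,
      aeval_X, algHom_C, Matrix.cons_val, Polynomial.C_0, Polynomial.algebraMap_eq, x, y, z, t]
    ring
  · simp [hCubic, x, y, z, t]
    ring

theorem multAt_D0curve {c : ℂ} (hc : c ≠ 0) : multAt D0curve ![0, c, 0] = 11 := by
  apply le_antisymm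
  · refine Nat.sInf_le ⟨![1, 0, 1], ?_⟩
    obtain ⟨Q, hQ, hQ0⟩ := restrictToLine_D0curve c ![1, 0, 1]
    have hQ1 : Q.eval 0 ≠ 0 := by
      rw [hQ0]
      simp [hCubic, hc]
      norm_num
    have hQ2 : Q ≠ 0 := by
      rintro rfl
      simp at hQ1
    have h0 : restrictToLine D0curve ![0, c, 0] ![1, 0, 1] ≠ 0 := by
      rw [hQ]
      exact mul_ne_zero (pow_ne_zero _ Polynomial.X_ne_zero) hQ2
    refine ⟨h0, ?_⟩
    rw [hQ] at h0 ⊢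
    have hX := Polynomial.rootMultiplicity_X_sub_C_pow (0 : ℂ) 11
    rw [Polynomial.C_0, sub_zero] at hX
    rw [Polynomial.rootMultiplicity_mul h0, hX, Polynomial.rootMultiplicity_eq_zero hQ1]
  · obtain ⟨w, hw⟩ : ∃ w, restrictToLine D0curve ![0, c, 0] w ≠ 0 := by
      obtain ⟨Q, hQ, hQ0⟩ := restrictToLine_D0curve c ![1, 0, 1]
      refine ⟨![1, 0, 1], ?_⟩
      rw [hQ]
      refine mul_ne_zero (pow_ne_zero _ Polynomial.X_ne_zero) ?_
      rintro rfl
      simp [hCubic, hc] at hQ0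
      norm_num at hQ0
    refine le_csInf ⟨_, w, hw, rfl⟩ ?_
    rintro _ ⟨w, hw, rfl⟩
    obtain ⟨Q, hQ, -⟩ := restrictToLine_D0curve c w
    rw [Polynomial.le_rootMultiplicity_iff hw, hQ]
    simp

theorem eval_D0curve_eq_zero_iff (v : Fin 3 → ℂ) : eval v D0curve = 0 ↔
    v 0 * v 2 * eval v hCubic * eval v f0Int = 0 := by
  rw [D0curve, ← three_mul_f0]
  simp

/-- The restriction of `f₀` to the line through `q` and `(a : 0 : b)`, up to a constant. -/
def lineRestriction (a b : ℂ) : Polynomial ℂ :=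
  aeval ![Polynomial.C a, Polynomial.X, Polynomial.C b] f0Int

theorem eval_lineRestriction (a b y : ℂ) :
    (lineRestriction a b).eval y = eval ![a, y, b] f0Int := by
  simp [lineRestriction, f0Int]

theorem natDegree_lineRestriction {a : ℂ} (ha : a ≠ 0) (b : ℂ) :
    (lineRestriction a b).natDegree = 4 := by
  have h : lineRestriction a b = Polynomial.C (3 * a ^ 6) * Polynomial.X ^ 4 +
      Polynomial.C (12 * a ^ 5 * b ^ 2 + 9 * a ^ 4 * b ^ 3) * Polynomial.X ^ 3 +
      Polynomial.C (18 * a ^ 4 * b ^ 4 + 19 * a ^ 3 * b ^ 5 + 9 * a ^ 2 * b ^ 6) *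
        Polynomial.X ^ 2 +
      Polynomial.C (12 * a ^ 3 * b ^ 6 + 11 * a ^ 2 * b ^ 7 + 6 * a * b ^ 8 + 3 * b ^ 9) *
        Polynomial.X +
      Polynomial.C (3 * a ^ 2 * b ^ 8 + a * b ^ 9 - 3 * b ^ 10) := by
    refine Polynomial.funext fun y => ?_
    simp [eval_lineRestriction, f0Int]
    ring
  rw [h]
  compute_degree!

theorem separable_lineRestriction {a b : ℂ} (hb : b ≠ 0) (h : eval ![a, 0, b] hCubic ≠ 0) :
    (lineRestriction a b).Separable := by
  have hder : Polynomial.derivative (lineRestriction a b) =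
      aeval ![Polynomial.C a, Polynomial.X, Polynomial.C b] (pderiv 1 f0Int) := by
    rw [pderiv_one_f0Int, lineRestriction, f0Int]
    refine Polynomial.funext fun y => ?_
    simp [Polynomial.derivative_pow]
    ring
  have hk : 3 * b ^ 16 * eval ![a, 0, b] hCubic ≠ 0 :=
    mul_ne_zero (mul_ne_zero (by norm_num) (pow_ne_zero _ hb)) h
  have key := congrArg (aeval ![Polynomial.C a, Polynomial.X, Polynomial.C b]) bezout_f0Int
  have hrhs : aeval ![Polynomial.C a, Polynomial.X, Polynomial.C b] (3 * X 2 ^ 16 * hCubic) =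
      Polynomial.C (3 * b ^ 16 * eval ![a, 0, b] hCubic) := by
    refine Polynomial.funext fun y => ?_
    simp [hCubic]
  rw [hrhs, map_add, map_mul, map_mul, ← hder, ← lineRestriction] at key
  refine ⟨Polynomial.C (3 * b ^ 16 * eval ![a, 0, b] hCubic)⁻¹ *
      aeval ![Polynomial.C a, Polynomial.X, Polynomial.C b] bezoutLeft,
    Polynomial.C (3 * b ^ 16 * eval ![a, 0, b] hCubic)⁻¹ *
      aeval ![Polynomial.C a, Polynomial.X, Polynomial.C b] bezoutRight, ?_⟩
  have hC : Polynomial.C (3 * b ^ 16 * eval ![a, 0, b] hCubic)⁻¹ *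
      Polynomial.C (3 * b ^ 16 * eval ![a, 0, b] hCubic) = 1 := by
    rw [← Polynomial.C_mul, inv_mul_cancel₀ hk, Polynomial.C_1]
  linear_combination Polynomial.C (3 * b ^ 16 * eval ![a, 0, b] hCubic)⁻¹ * key + hC

theorem card_roots_lineRestriction {a b : ℂ} (ha : a ≠ 0) (hb : b ≠ 0)
    (h : eval ![a, 0, b] hCubic ≠ 0) : (lineRestriction a b).roots.toFinset.card = 4 := by
  rw [Multiset.toFinset_card_of_nodup
    (Polynomial.nodup_roots (separable_lineRestriction hb h)),
    ← natDegree_lineRestriction ha b]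
  exact (Polynomial.splits_iff_card_roots.mp (IsAlgClosed.splits _))

theorem linForm_dvd_D0curve {α : Fin 3 → ℂ} (hα : α ≠ 0) (h1 : α 1 = 0)
    (h : α 2 * -α 0 * eval ![α 2, 0, -α 0] hCubic = 0) : linForm α ∣ D0curve := by
  have hl : linForm α = C (α 0) * X 0 + C (α 2) * X 2 := by
    simp [linForm, Fin.sum_univ_three, h1]
  rw [hl, D0curve]
  by_cases h0 : α 0 = 0
  · have h2 : α 2 ≠ 0 := by
      intro h2
      apply hα
      funext i
      fin_cases i <;> assumption
    refine ⟨C (α 2)⁻¹ * X 0 * hCubic * f0, ?_⟩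
    have hC : (C (α 2) * C (α 2)⁻¹ : S3) = 1 := by rw [← C_mul, mul_inv_cancel₀ h2, C_1]
    rw [h0, C_0]
    linear_combination (-(X 0 * X 2 * hCubic * f0)) * hC
  · refine Dvd.dvd.mul_right ?_ f0
    have hC : (C (α 0) * C (α 0)⁻¹ : S3) = 1 := by rw [← C_mul, mul_inv_cancel₀ h0, C_1]
    set σ : S3 →ₐ[ℂ] S3 := aeval ![C (-α 2 / α 0) * X 2, X 1, X 2] with hσ
    have hX (i : Fin 3) : (C (α 0) * X 0 + C (α 2) * X 2 : S3) ∣ X i - σ (X i) := by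
      fin_cases i
      · refine ⟨C (α 0)⁻¹, ?_⟩
        simp only [hσ, Fin.zero_eta, aeval_X, Matrix.cons_val, div_eq_mul_inv, C_mul, C_neg]
        linear_combination (-X 0) * hC
      · simp [hσ]
      · simp [hσ]
    have hz : σ (X 0 * X 2 * hCubic) = 0 := by
      refine MvPolynomial.funext fun p => ?_
      simp only [hσ, hCubic, map_add, map_sub, map_mul, map_pow, map_ofNat, aeval_X,
        Matrix.cons_val, eval_X, eval_C, map_zero] at h ⊢
      linear_combination (norm := (field_simp; ring)) (-(p 2 ^ 5 / α 0 ^ 5)) * h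
    have hdvd := dvd_sub_of_dvd_X_sub hX (X 0 * X 2 * hCubic)
    rwa [hz, sub_zero] at hdvd

theorem exists_qPoint_rep_eq : ∃ c : ℂ, c ≠ 0 ∧ qPoint.rep = ![0, c, 0] := by
  obtain ⟨c, hc⟩ := Projectivization.exists_smul_eq_mk_rep ℂ (![0, 1, 0] : Fin 3 → ℂ)
    fun h => one_ne_zero (congrFun h 1)
  refine ⟨c, c.ne_zero, hc.symm.trans ?_⟩
  funext i
  fin_cases i <;> simp [Units.smul_def]

/-- The point `(a : y : b)` for `a ≠ 0`. -/
def linePoint {a : ℂ} (ha : a ≠ 0) (b y : ℂ) : Pt :=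
  Projectivization.mk ℂ ![a, y, b] fun h => ha (by simpa using congrFun h 0)

theorem linePoint_injective {a : ℂ} (ha : a ≠ 0) (b : ℂ) :
    Function.Injective (linePoint ha b) := by
  intro y y' h
  obtain ⟨u, hu⟩ := (Projectivization.mk_eq_mk_iff' ℂ _ _ _ _).mp h
  have h0 : u * a = a := by simpa using congrFun hu 0
  have h1 : u * y' = y := by simpa using congrFun hu 1
  rw [mul_eq_right₀ ha] at h0
  rw [← h1, h0, one_mul]

theorem qPoint_ne_linePoint {a : ℂ} (ha : a ≠ 0) (b y : ℂ) : qPoint ≠ linePoint ha b y := by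
  intro h
  obtain ⟨u, hu⟩ := (Projectivization.mk_eq_mk_iff' ℂ _ _ _ _).mp h.symm
  apply ha
  simpa using (congrFun hu 0).symm

theorem exists_linePoint_rep_eq {a : ℂ} (ha : a ≠ 0) (b y : ℂ) :
    ∃ u : ℂ, u ≠ 0 ∧ (linePoint ha b y).rep = ![u * a, u * y, u * b] := by
  obtain ⟨u, hu⟩ := Projectivization.exists_smul_eq_mk_rep ℂ ![a, y, b]
    fun h => ha (by simpa using congrFun h 0)
  refine ⟨u, u.ne_zero, hu.symm.trans ?_⟩
  funext i
  fin_cases i <;> simp [Units.smul_def]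

theorem eq_qPoint_of_rep {p : Pt} (h0 : p.rep 0 = 0) (h2 : p.rep 2 = 0) : p = qPoint := by
  rw [← p.mk_rep, qPoint, Projectivization.mk_eq_mk_iff']
  refine ⟨p.rep 1, ?_⟩
  funext i
  fin_cases i <;> simp [h0, h2]

theorem eq_linePoint_of_rep {p : Pt} {a b t : ℂ} (ha : a ≠ 0) (ht : t ≠ 0)
    (h0 : p.rep 0 = t * a) (h2 : p.rep 2 = t * b) : linePoint ha b (p.rep 1 / t) = p := by
  rw [← p.mk_rep, linePoint, Projectivization.mk_eq_mk_iff']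
  refine ⟨t⁻¹, ?_⟩
  funext i
  fin_cases i <;> simp [h0, h2, p.mk_rep] <;> field_simp

theorem eval_f0Int_mul (u a y b : ℂ) :
    eval ![u * a, u * y, u * b] f0Int = u ^ 10 * eval ![a, y, b] f0Int := by
  simp [f0Int]
  ring

theorem eval_hCubic_mul (v : Fin 3 → ℂ) (t a b : ℂ) (h0 : v 0 = t * a) (h2 : v 2 = t * b) :
    eval v hCubic = t ^ 3 * eval ![a, 0, b] hCubic := by
  simp [hCubic, h0, h2]
  ring

/-- A line through `q` that is not a component of `D₀` meets `D₀` in `q` and in the points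
corresponding to the roots of `lineRestriction`. -/
theorem lineSet_inter_curveSet {α : Fin 3 → ℂ} (h1 : α 1 = 0) (h2 : α 2 ≠ 0) (h0 : -α 0 ≠ 0)
    (hh : eval ![α 2, 0, -α 0] hCubic ≠ 0) :
    lineSet α ∩ curveSet D0curve = insert qPoint
      (linePoint h2 (-α 0) '' ((lineRestriction (α 2) (-α 0)).roots.toFinset : Set ℂ)) := by
  have hne : lineRestriction (α 2) (-α 0) ≠ 0 := (separable_lineRestriction h0 hh).ne_zero
  ext p
  simp only [lineSet, curveSet, Set.mem_inter_iff, Set.mem_ofPred_eq, Fin.sum_univ_three, h1,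
    zero_mul, add_zero, Set.mem_insert_iff, Set.mem_image, SetLike.mem_coe, Multiset.mem_toFinset,
    Polynomial.mem_roots hne, Polynomial.IsRoot.def, eval_lineRestriction,
    eval_D0curve_eq_zero_iff]
  constructor
  · rintro ⟨hl, hc⟩
    obtain ⟨t, ht⟩ : ∃ t, t * α 2 = p.rep 0 := ⟨p.rep 0 / α 2, div_mul_cancel₀ _ h2⟩
    have ht2 : p.rep 2 = t * -α 0 := by
      apply mul_left_cancel₀ h2
      linear_combination hl + α 0 * ht
    by_cases h : t = 0
    · left
      exact eq_qPoint_of_rep (by simp [← ht, h]) (by simp [ht2, h])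
    · right
      refine ⟨p.rep 1 / t, ?_, eq_linePoint_of_rep h2 h ht.symm ht2⟩
      have hrep : p.rep = ![t * α 2, t * (p.rep 1 / t), t * -α 0] := by
        funext i
        fin_cases i <;> simp [ht, ht2, mul_div_cancel₀ _ h]
      have hf : eval p.rep f0Int = t ^ 10 * eval ![α 2, p.rep 1 / t, -α 0] f0Int := by
        conv_lhs => rw [hrep]
        rw [eval_f0Int_mul]
      rw [hf, eval_hCubic_mul _ _ _ _ ht.symm ht2, ← ht, ht2] at hc
      simpa [h, h2, hh, neg_ne_zero.mp h0] using hc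
  · rintro (rfl | ⟨y, hy, rfl⟩)
    · obtain ⟨c, -, hc⟩ := exists_qPoint_rep_eq
      simp [hc]
    · obtain ⟨u, -, hu⟩ := exists_linePoint_rep_eq h2 (-α 0) y
      rw [hu, eval_f0Int_mul, hy]
      refine ⟨?_, by simp⟩
      simp
      ring

theorem isModularPoint_qPoint : IsModularPoint D0curve 15 qPoint := by
  intro α hα hq hdvd
  obtain ⟨c, hc, hrep⟩ := exists_qPoint_rep_eq
  rw [hrep, multAt_D0curve hc]
  have h1 : α 1 = 0 := by
    simpa [hrep, Fin.sum_univ_three, hc] using hq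
  have h : α 2 * -α 0 * eval ![α 2, 0, -α 0] hCubic ≠ 0 :=
    fun h => hdvd (linForm_dvd_D0curve hα h1 h)
  obtain ⟨⟨h2, h0⟩, hh⟩ : (α 2 ≠ 0 ∧ -α 0 ≠ 0) ∧ eval ![α 2, 0, -α 0] hCubic ≠ 0 := by
    simpa only [mul_ne_zero_iff] using h
  rw [lineSet_inter_curveSet h1 h2 h0 hh, Set.ncard_insert_of_notMem,
    Set.ncard_image_of_injective _ (linePoint_injective h2 _), Set.ncard_coe_finset,
    card_roots_lineRestriction h2 h0 hh]
  rintro ⟨y, -, hy⟩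
  exact qPoint_ne_linePoint h2 _ y hy.symm

end ModularPoint

/-- A counter-example to the conjecture that supersolvable curves are free: `q = (0:1:0)`
is a modular point of the degree 15 curve `D₀ : x z h(x,z) f₀ = 0`, so `D₀` is
supersolvable; nevertheless `D₀` is a 4-syzygy curve with exponents `(8,8,8,8)`, hence a
maximal Tjurina curve of type `(15,8)`, and is not free. -/
theorem statement13 :
    IsModularPoint D0curve 15 qPoint ∧ IsSupersolvable D0curve 15 ∧
    (∃ v, IsMinGenSyz D0curve 4 (fun _ => 8) v) ∧
    IsMaxTjurina D0curve 15 8 ∧ ¬ IsFreeCurve D0curve := by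
  exact ⟨isModularPoint_qPoint, ⟨qPoint, isModularPoint_qPoint⟩, ⟨syzVec, isMinGenSyz_syzVec⟩,
    isMaxTjurina_D0curve, not_isFreeCurve_D0curve⟩

end
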